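/- Define d_N² := inf over all complex tuples (a_1, …, a_N) of (1/2π) ∫_{-∞}^{+∞} |1 - ζ(1/2 + it)·∑_{n=1}^{N} a_n n^{-(1/2+it)}|² dt/(1/4 + t²). Then the Riemann Hypothesis (every nontrivial zero of the Riemann zeta function ζ has real part 1/2) holds if and only if lim_{N→∞} d_N = 0. -/

import Mathlib

open Real Complex MeasureTheory Filter

/-- `d_N²`: the infimum over Dirichlet polynomials of length `N` in the
Nyman–Beurling criterion. -/
noncomputable def dNsq (N : ℕ) : ℝ :=
  ⨅ a : Fin N → ℂ, (1 / (2 * Real.pi)) *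
    ∫ t : ℝ, ‖1 - riemannZeta (1 / 2 + t * Complex.I) *
        ∑ n : Fin N, a n * ((n : ℂ) + 1) ^ (-(1 / 2 + t * Complex.I))‖ ^ 2
      / (1 / 4 + t ^ 2)


/-- the auxiliary function `t ↦ {t}` on `(1, ∞)` -/
noncomputable def bdFr : ℝ → ℂ := Set.indicator (Set.Ioi 1) (fun t => ((Int.fract t : ℝ) : ℂ))

lemma bdFr_norm_le (t : ℝ) : ‖bdFr t‖ ≤ 1 := by
  unfold bdFr
  by_cases h : t ∈ Set.Ioi (1:ℝ)
  · rw [Set.indicator_of_mem h, Complex.norm_real, Real.norm_eq_abs, abs_of_nonneg (Int.fract_nonneg t)]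
    exact (Int.fract_lt_one t).le
  · rw [Set.indicator_of_notMem h]; simp

lemma bdFr_meas : Measurable bdFr := by
  unfold bdFr
  refine Measurable.indicator ?_ measurableSet_Ioi
  exact Complex.measurable_ofReal.comp measurable_fract

lemma bdFr_diff {s : ℂ} (hs : 0 < s.re) : DifferentiableAt ℂ (fun s => mellin bdFr (-s)) s := by
  have h : DifferentiableAt ℂ (mellin bdFr) (-s) := by
    refine mellin_differentiableAt_of_isBigO_rpow (a := 0) (b := -s.re - 1) ?_ ?_ (by simpa) ?_ (by simp)
    · refine LocallyIntegrable.locallyIntegrableOn ?_ _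
      refine (locallyIntegrable_const (1:ℝ)).mono bdFr_meas.aestronglyMeasurable ?_
      filter_upwards with t
      simpa using bdFr_norm_le t
    · refine Asymptotics.IsBigO.of_bound 1 ?_
      filter_upwards with t
      simpa using bdFr_norm_le t
    · refine Asymptotics.IsBigO.of_bound 1 ?_
      have : Set.Ioo (0:ℝ) 1 ∈ nhdsWithin (0:ℝ) (Set.Ioi 0) := Ioo_mem_nhdsGT one_pos
      filter_upwards [this] with t ht
      have : bdFr t = 0 := by
        unfold bdFr; rw [Set.indicator_of_notMem]; simpa using ht.2.le
      rw [this]; simp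
  exact h.comp s (differentiableAt_id.neg)

lemma bdFr_mellin (s : ℂ) : mellin bdFr (-s) = ∫ t in Set.Ioi (1:ℝ), ((Int.fract t : ℝ) : ℂ) * (t : ℂ) ^ (-(s+1)) := by
  unfold mellin bdFr
  have : ∀ t : ℝ, (t:ℂ) ^ (-s - 1) • Set.indicator (Set.Ioi 1) (fun t => ((Int.fract t : ℝ) : ℂ)) t =
      Set.indicator (Set.Ioi 1) (fun t : ℝ => ((Int.fract t : ℝ) : ℂ) * (t : ℂ) ^ (-(s+1))) t := by
    intro t
    by_cases h : t ∈ Set.Ioi (1:ℝ)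
    · rw [Set.indicator_of_mem h, Set.indicator_of_mem h, smul_eq_mul, mul_comm]; ring_nf
    · rw [Set.indicator_of_notMem h, Set.indicator_of_notMem h]; simp
  simp_rw [this]
  rw [setIntegral_indicator measurableSet_Ioi]
  congr 2
  ext x; simp

lemma bdFr_pt_bound (s : ℂ) {t : ℝ} (ht : t ∈ Set.Ioi (1:ℝ)) :
    ‖((Int.fract t : ℝ) : ℂ) * (t : ℂ) ^ (-(s+1))‖ ≤ t ^ (-(s.re+1)) := by
  have ht0 : (0:ℝ) < t := lt_trans one_pos ht
  rw [norm_mul, Complex.norm_real, Real.norm_eq_abs, abs_of_nonneg (Int.fract_nonneg t),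
    Complex.norm_cpow_eq_rpow_re_of_pos ht0]
  have h1 := (Int.fract_lt_one t).le
  have : (0:ℝ) ≤ t ^ (-(s+1)).re := by positivity
  calc _ ≤ 1 * t ^ (-(s+1)).re := by gcongr
    _ = _ := by simp

lemma bdFr_bound {s : ℂ} (hs : 0 < s.re) : ‖mellin bdFr (-s)‖ ≤ 1 / s.re := by
  rw [bdFr_mellin]
  have hi := integrableOn_Ioi_rpow_of_lt (a := -(s.re+1)) (c := 1) (by linarith) one_pos
  refine (norm_integral_le_of_norm_le hi ?_).trans (le_of_eq ?_)
  · exact (ae_restrict_mem measurableSet_Ioi).mono fun t ht => bdFr_pt_bound s ht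
  · rw [integral_Ioi_rpow_of_lt (by linarith) one_pos]
    simp

lemma zeta_eq_aux {s : ℂ} (hs : 1 < s.re) :
    riemannZeta₁ s = s - s * (s - 1) * mellin bdFr (-s) := by
  have hs1 : s ≠ 1 := by rintro rfl; simp at hs
  have hs1' : s - 1 ≠ 0 := sub_ne_zero.mpr hs1
  have h0 : riemannZeta s = s * ∫ t in Set.Ioi (1:ℝ), (∑ k ∈ Finset.Icc 1 ⌊t⌋₊, (1 : ℕ → ℂ) k) * (t:ℂ) ^ (-(s + 1)) := by
    rw [← LSeries_one_eq_riemannZeta hs]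
    refine LSeries_eq_mul_integral' (r := 1) _ zero_le_one hs ?_
    refine Asymptotics.IsBigO.of_bound 1 ?_
    filter_upwards with n
    simp
  have hfr : IntegrableOn (fun t : ℝ => ((Int.fract t : ℝ) : ℂ) * (t : ℂ) ^ (-(s+1))) (Set.Ioi 1) := by
    have hi := integrableOn_Ioi_rpow_of_lt (a := -(s.re+1)) (c := 1) (by linarith) one_pos
    refine Integrable.mono' hi ?_ ((ae_restrict_mem measurableSet_Ioi).mono fun t ht => bdFr_pt_bound s ht)
    refine Measurable.aestronglyMeasurable ?_
    exact (Complex.measurable_ofReal.comp measurable_fract).mul (Complex.measurable_ofReal.pow_const _)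
  have hp := integrableOn_Ioi_cpow_of_lt (a := -s) (c := 1) (by simpa) one_pos
  have h1 : ∫ t in Set.Ioi (1:ℝ), (∑ k ∈ Finset.Icc 1 ⌊t⌋₊, (1 : ℕ → ℂ) k) * (t:ℂ) ^ (-(s + 1))
      = (∫ t in Set.Ioi (1:ℝ), (t:ℂ) ^ (-s)) - mellin bdFr (-s) := by
    rw [bdFr_mellin, ← integral_sub hp hfr]
    refine setIntegral_congr_fun measurableSet_Ioi fun t ht => ?_
    have ht0 : (0:ℝ) < t := lt_trans one_pos ht
    have ht0' : (t:ℂ) ≠ 0 := by exact_mod_cast ht0.ne'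
    have e1 : (t:ℂ) ^ (-s) = t * (t:ℂ) ^ (-(s+1)) := by
      rw [show -s = 1 + -(s+1) by ring, cpow_add _ _ ht0', cpow_one]
    have e2 : (t:ℂ) = (⌊t⌋₊ : ℂ) + ((Int.fract t : ℝ) : ℂ) := by
      have h := Int.floor_add_fract t
      have h2 : ((⌊t⌋₊ : ℕ) : ℝ) = ((⌊t⌋ : ℤ) : ℝ) := natCast_floor_eq_intCast_floor ht0.le
      have h3 : t = (⌊t⌋₊ : ℝ) + Int.fract t := by rw [h2]; exact h.symm
      exact_mod_cast h3
    simp only [Pi.one_apply, Finset.sum_const, Nat.card_Icc, add_tsub_cancel_right, nsmul_eq_mul, mul_one]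
    rw [e1, ← sub_mul]
    congr 1
    rw [eq_sub_iff_add_eq]; exact e2.symm
  rw [integral_Ioi_cpow_of_lt (by simpa) one_pos] at h1
  have h2 := riemannZeta_eq_inv_sub_mul hs1
  have h3 : riemannZeta₁ s = (s-1) * riemannZeta s := by rw [h2]; field_simp
  rw [h3, h0, h1]
  have : -s + 1 ≠ 0 := by
    intro h; apply hs1'; linear_combination -h
  have e : (-((1:ℝ):ℂ) ^ (-s + 1) / (-s + 1)) = 1 / (s-1) := by
    simp; rw [show s - 1 = -(-s+1) by ring, inv_neg]; field_simp
  rw [e]; field_simp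

lemma zeta1_eq {s : ℂ} (hs : 0 < s.re) :
    riemannZeta₁ s = s - s * (s - 1) * mellin bdFr (-s) := by
  have hU : IsOpen {s : ℂ | 0 < s.re} := isOpen_lt continuous_const Complex.continuous_re
  have h1 : AnalyticOnNhd ℂ riemannZeta₁ {s : ℂ | 0 < s.re} :=
    differentiable_riemannZeta₁.differentiableOn.analyticOnNhd hU
  have h2 : AnalyticOnNhd ℂ (fun s => s - s * (s - 1) * mellin bdFr (-s)) {s : ℂ | 0 < s.re} := by
    refine DifferentiableOn.analyticOnNhd (fun s hs => ?_) hU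
    refine DifferentiableAt.differentiableWithinAt ?_
    have := bdFr_diff (s := s) hs
    fun_prop
  refine h1.eqOn_of_preconnected_of_eventuallyEq h2 (convex_halfSpace_re_gt 0).isPreconnected (z₀ := 2) (by simp) ?_ hs
  have : {s : ℂ | 1 < s.re} ∈ nhds (2:ℂ) :=
    (isOpen_lt continuous_const Complex.continuous_re).mem_nhds (by simp)
  filter_upwards [this] with z hz
  exact zeta_eq_aux hz

lemma zeta1_bound {s : ℂ} (hs : 1/10 ≤ s.re) : ‖riemannZeta₁ s‖ ≤ 11 * (1 + ‖s‖) ^ 2 := by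
  have h0 : 0 < s.re := by linarith
  rw [zeta1_eq h0]
  have hb := bdFr_bound h0
  have hb' : 1 / s.re ≤ 10 := by
    rw [div_le_iff₀ h0]; linarith
  calc _ ≤ ‖s‖ + ‖s * (s-1) * mellin bdFr (-s)‖ := norm_sub_le _ _
    _ ≤ ‖s‖ + ‖s‖ * (‖s‖ + 1) * 10 := by
      rw [norm_mul, norm_mul]
      have : ‖s - 1‖ ≤ ‖s‖ + 1 := by simpa using norm_sub_le s 1
      gcongr
      linarith
    _ ≤ _ := by nlinarith [norm_nonneg s]

lemma zeta1_eq_mul {s : ℂ} (hs : s ≠ 1) : riemannZeta₁ s = (s-1) * riemannZeta s := by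
  have hs1' : s - 1 ≠ 0 := sub_ne_zero.mpr hs
  rw [riemannZeta_eq_inv_sub_mul hs]; field_simp

lemma zeta1_conj (s : ℂ) : riemannZeta₁ ((starRingEnd ℂ) s) = (starRingEnd ℂ) (riemannZeta₁ s) := by
  by_cases h : s = 1
  · subst h; simp
  · have h' : (starRingEnd ℂ) s ≠ 1 := by
      intro h2; apply h; have := congrArg (starRingEnd ℂ) h2; simpa using this
    rw [zeta1_eq_mul h, zeta1_eq_mul h', riemannZeta_conj]; simp

lemma bd_vstrip {f : ℂ → ℂ} {a b C : ℝ} (hab : a < b)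
    (hd : ∀ z : ℂ, a ≤ z.re → z.re ≤ b → DifferentiableAt ℂ f z)
    (hg : ∃ A B : ℝ, ∀ z : ℂ, a ≤ z.re → z.re ≤ b → 1 ≤ |z.im| → ‖f z‖ ≤ A * Real.exp (B * |z.im|))
    (ha : ∀ z : ℂ, z.re = a → ‖f z‖ ≤ C) (hb : ∀ z : ℂ, z.re = b → ‖f z‖ ≤ C)
    {z : ℂ} (hza : a ≤ z.re) (hzb : z.re ≤ b) : ‖f z‖ ≤ C := by
  obtain ⟨A, B, hAB⟩ := hg
  have hpos : 0 < π / (b - a) := div_pos pi_pos (by linarith)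
  set c := π / (b - a) / 2 with hc
  have hc0 : 0 < c := by positivity
  refine PhragmenLindelof.vertical_strip (a := a) (b := b) ?_ ⟨c, by rw [hc]; linarith, |B| / c, ?_⟩ ha hb hza hzb
  · refine DifferentiableOn.diffContOnCl ?_
    intro w hw
    have : closure (re ⁻¹' Set.Ioo a b) ⊆ re ⁻¹' Set.Icc a b :=
      closure_minimal (Set.preimage_mono Set.Ioo_subset_Icc_self) (isClosed_Icc.preimage Complex.continuous_re)
    have h := this hw
    exact (hd w h.1 h.2).differentiableWithinAt
  · refine Asymptotics.IsBigO.of_bound |A| ?_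
    have h1 : ∀ᶠ w : ℂ in comap (abs ∘ im) atTop, 1 ≤ |w.im| :=
      (tendsto_comap (f := abs ∘ im)).eventually (eventually_ge_atTop (1:ℝ))
    have h2 := h1.filter_mono (inf_le_left (b := 𝓟 (re ⁻¹' Set.Ioo a b)))
    have h3 : ∀ᶠ w : ℂ in comap (abs ∘ im) atTop ⊓ 𝓟 (re ⁻¹' Set.Ioo a b), w ∈ re ⁻¹' Set.Ioo a b :=
      (eventually_principal.mpr fun _ h => h).filter_mono inf_le_right
    filter_upwards [h2, h3] with w hw1 hw2
    refine (hAB w hw2.1.le hw2.2.le hw1).trans ?_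
    rw [Real.norm_eq_abs, abs_of_pos (Real.exp_pos _)]
    refine mul_le_mul (le_abs_self A) ?_ (Real.exp_pos _).le (abs_nonneg _)
    refine Real.exp_le_exp.mpr ?_
    have e1 : B * |w.im| ≤ |B| * |w.im| := mul_le_mul_of_nonneg_right (le_abs_self B) (abs_nonneg _)
    have e2 : c * |w.im| ≤ Real.exp (c * |w.im|) := by linarith [Real.add_one_le_exp (c * |w.im|)]
    calc B * |w.im| ≤ |B| * |w.im| := e1
      _ = |B| / c * (c * |w.im|) := by field_simp
      _ ≤ _ := by gcongr

lemma bd_gamma_norm_le {s : ℂ} (hs : 0 < s.re) : ‖Complex.Gamma s‖ ≤ Real.Gamma s.re := by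
  rw [Complex.Gamma_eq_integral hs, Real.Gamma_eq_integral hs, Complex.GammaIntegral]
  refine norm_integral_le_of_norm_le (Real.GammaIntegral_convergent hs) ?_
  refine (ae_restrict_mem measurableSet_Ioi).mono fun t ht => ?_
  rw [norm_mul, Complex.norm_cpow_eq_rpow_re_of_pos ht, Complex.norm_real, Real.norm_eq_abs,
    abs_of_pos (Real.exp_pos _)]
  simp

lemma bd_gamma_bdd : ∃ M : ℝ, 0 < M ∧ ∀ s : ℂ, 1/2 ≤ s.re → s.re ≤ 3/2 → ‖Complex.Gamma s‖ ≤ M := by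
  have hc : ContinuousOn Real.Gamma (Set.Icc (1/2) (3/2)) := by
    intro x hx
    refine (Real.differentiableAt_Gamma ?_).continuousAt.continuousWithinAt
    intro m h
    have : (0:ℝ) ≤ m := m.cast_nonneg
    have := hx.1
    linarith
  obtain ⟨M, hM⟩ := isCompact_Icc.exists_bound_of_continuousOn hc
  refine ⟨|M| + 1, by positivity, fun s h1 h2 => ?_⟩
  refine (bd_gamma_norm_le (by linarith)).trans ?_
  have := hM s.re ⟨h1, h2⟩
  rw [Real.norm_eq_abs] at this
  linarith [le_abs_self M, le_abs_self (Real.Gamma s.re)]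

lemma bd_gamma_half (t : ℝ) : ‖Complex.Gamma (1/2 + t * I)‖ ≤ 3 * Real.exp (-(π * |t| / 2)) := by
  have h := Complex.Gamma_mul_Gamma_one_sub (1/2 + t * I)
  have hc : (1 : ℂ) - (1/2 + t * I) = (starRingEnd ℂ) (1/2 + t*I) := by
    apply Complex.ext <;> simp; norm_num
  rw [hc, Complex.Gamma_conj, Complex.mul_conj, Complex.normSq_eq_norm_sq] at h
  have hs : Complex.sin (π * (1/2 + t * I)) = ((Real.cosh (π * t) : ℝ) : ℂ) := by
    rw [show (π:ℂ) * (1/2 + t*I) = (π * t : ℝ) * I + π/2 by push_cast; ring, Complex.sin_add_pi_div_two,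
      Complex.cos_mul_I]
    push_cast; rfl
  rw [hs] at h
  have h2 : ‖Complex.Gamma (1/2 + t * I)‖ ^ 2 = π / Real.cosh (π * t) := by exact_mod_cast h
  have h3 : Real.exp (π * |t|) / 2 ≤ Real.cosh (π * t) := by
    rw [← Real.cosh_abs, abs_mul, abs_of_pos pi_pos, Real.cosh_eq]
    linarith [Real.exp_pos (-(π * |t|))]
  have h4 : (3 * Real.exp (-(π * |t| / 2)))^2 = 9 / Real.exp (π * |t|) := by
    rw [mul_pow, ← Real.exp_nat_mul, div_eq_mul_inv 9, ← Real.exp_neg]; norm_num; ring_nf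
  refine abs_le_of_sq_le_sq' ?_ (by positivity) |>.2
  rw [h2, h4]
  have hp := Real.pi_lt_d2
  rw [div_le_div_iff₀ (Real.cosh_pos _) (Real.exp_pos _)]
  have := Real.exp_pos (π * |t|)
  nlinarith

lemma bd_gamma_pos : ∃ C : ℝ, 0 < C ∧ ∀ σ T : ℝ, 1/2 ≤ σ → σ ≤ 3/2 → 0 ≤ T →
    ‖Complex.Gamma (σ + T * I)‖ ≤ C * (1 + T) ^ (σ - 1/2) * Real.exp (-(π * T / 2)) := by
  obtain ⟨M, hM0, hM⟩ := bd_gamma_bdd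
  refine ⟨6 * 3, by norm_num, fun σ T h1 h2 hT => ?_⟩
  have hT1 : (0:ℝ) < 1 + T := by linarith
  set f : ℂ → ℂ := fun z => Complex.Gamma z * Complex.exp (-I * π * z / 2) / (z - T * I + 1) / ((1 + T : ℝ) : ℂ) ^ (z - 1/2) with hf
  have hn : ∀ z : ℂ, ‖f z‖ = ‖Complex.Gamma z‖ * Real.exp (π * z.im / 2) / ‖z - T * I + 1‖ / (1 + T) ^ (z.re - 1/2) := by
    intro z
    rw [hf]
    simp only [norm_div, norm_mul]
    rw [Complex.norm_cpow_eq_rpow_re_of_pos hT1, Complex.norm_exp]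
    congr 3
    · congr 1; simp
    · simp
  have hden : ∀ z : ℂ, 1/2 ≤ z.re → 1 ≤ ‖z - T * I + 1‖ := by
    intro z hz
    refine le_trans ?_ (Complex.abs_re_le_norm _)
    refine le_trans ?_ (le_abs_self _)
    simp; linarith
  have hden2 : ∀ z : ℂ, |z.im - T| ≤ ‖z - T * I + 1‖ := by
    intro z
    refine le_trans ?_ (Complex.abs_im_le_norm _)
    simp
  have hkey : ‖f (σ + T * I)‖ ≤ 6 := by
    refine bd_vstrip (a := 1/2) (b := 3/2) (by norm_num) ?_ ⟨M, π/2, ?_⟩ ?_ ?_ (by simpa using h1) (by simpa using h2)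
    · intro z hz1 hz2
      have e1 : z - T * I + 1 ≠ 0 := by
        intro h; have := hden z hz1; rw [h] at this; simp at this; linarith
      have e2 : DifferentiableAt ℂ Complex.Gamma z := by
        refine Complex.differentiableAt_Gamma _ fun m h => ?_
        have : z.re = -m := by rw [h]; simp
        have : (0:ℝ) ≤ m := m.cast_nonneg
        linarith
      have e3 : ((1 + T : ℝ) : ℂ) ≠ 0 := by exact_mod_cast hT1.ne'
      have e4 : ((1 + T : ℝ) : ℂ) ^ (z - 1/2) ≠ 0 := by
        rw [Complex.cpow_ne_zero_iff]; left; exact e3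
      have e5 : DifferentiableAt ℂ (fun z => ((1 + T : ℝ) : ℂ) ^ (z - 1/2)) z :=
        DifferentiableAt.const_cpow (by fun_prop) (Or.inl e3)
      rw [hf]
      exact ((e2.mul (by fun_prop)).div (by fun_prop) e1).div e5 e4
    · intro z hz1 hz2 _
      rw [hn]
      have g1 := hden z hz1
      have g2 : 1 ≤ (1 + T) ^ (z.re - 1/2) := Real.one_le_rpow (by linarith) (by linarith)
      have g3 := hM z hz1 hz2
      have g4 : Real.exp (π * z.im / 2) ≤ Real.exp (π / 2 * |z.im|) := by
        apply Real.exp_le_exp.mpr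
        nlinarith [pi_pos, le_abs_self z.im]
      calc _ ≤ ‖Complex.Gamma z‖ * Real.exp (π * z.im / 2) / ‖z - T * I + 1‖ := div_le_self (by positivity) g2
        _ ≤ ‖Complex.Gamma z‖ * Real.exp (π * z.im / 2) := div_le_self (by positivity) g1
        _ ≤ _ := by gcongr
    · intro z hz
      rw [hn, hz]
      have hz' : z = 1/2 + z.im * I := by
        apply Complex.ext <;> simp [hz]
      have g0 := bd_gamma_half z.im
      rw [← hz'] at g0
      have g1 := hden z hz.ge
      have g4 : Real.exp (-(π * |z.im| / 2)) * Real.exp (π * z.im / 2) ≤ 1 := by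
        rw [← Real.exp_add]; apply Real.exp_le_one_iff.mpr
        nlinarith [pi_pos, le_abs_self z.im]
      rw [sub_self, Real.rpow_zero, div_one]
      calc _ ≤ ‖Complex.Gamma z‖ * Real.exp (π * z.im / 2) := div_le_self (by positivity) g1
        _ ≤ 3 * Real.exp (-(π * |z.im| / 2)) * Real.exp (π * z.im / 2) := by gcongr
        _ ≤ 6 := by linarith
    · intro z hz
      rw [hn, hz]
      have hz' : z = (1/2 + z.im * I) + 1 := by
        apply Complex.ext <;> simp [hz]; norm_num
      have g0 := bd_gamma_half z.im
      have hne : (1/2 + z.im * I : ℂ) ≠ 0 := by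
        intro h; have := congrArg Complex.re h; simp at this
      have g1 := hden z (by linarith)
      have g2 := hden2 z
      have g4 : Real.exp (-(π * |z.im| / 2)) * Real.exp (π * z.im / 2) ≤ 1 := by
        rw [← Real.exp_add]; apply Real.exp_le_one_iff.mpr
        nlinarith [pi_pos, le_abs_self z.im]
      have g5 : ‖Complex.Gamma z‖ ≤ (1/2 + |z.im|) * (3 * Real.exp (-(π * |z.im| / 2))) := by
        rw [hz', Complex.Gamma_add_one _ hne, norm_mul]
        have : ‖(1/2 + z.im * I : ℂ)‖ ≤ 1/2 + |z.im| := by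
          refine (norm_add_le _ _).trans ?_
          simp
        rw [← hz']
        gcongr
      rw [show (3/2 - 1/2 : ℝ) = 1 by norm_num, Real.rpow_one, div_div, div_le_iff₀ (by positivity)]
      have g6 : |z.im| ≤ T + |z.im - T| := by
        have := abs_add_le T (z.im - T)
        rw [abs_of_nonneg hT] at this
        simpa using this
      calc _ ≤ (1/2 + |z.im|) * (3 * Real.exp (-(π * |z.im| / 2))) * Real.exp (π * z.im / 2) := by gcongr
        _ = (1/2 + |z.im|) * 3 * (Real.exp (-(π * |z.im| / 2)) * Real.exp (π * z.im / 2)) := by ring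
        _ ≤ (1/2 + |z.im|) * 3 * 1 := by gcongr
        _ ≤ _ := by nlinarith [abs_nonneg z.im, abs_nonneg (z.im - T)]
  rw [hn] at hkey
  have r1 : ‖(σ + T * I : ℂ) - T * I + 1‖ ≤ 3 := by
    rw [show (σ + T * I : ℂ) - T * I + 1 = ((σ + 1 : ℝ) : ℂ) by push_cast; ring, Complex.norm_real,
      Real.norm_eq_abs, abs_of_pos (by linarith)]
    linarith
  have r0 : 0 < ‖(σ + T * I : ℂ) - T * I + 1‖ := lt_of_lt_of_le one_pos (hden _ (by simpa using h1))
  have hre : (σ + T * I : ℂ).re = σ := by simp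
  have him : (σ + T * I : ℂ).im = T := by simp
  rw [hre, him] at hkey
  have p1 : (0:ℝ) < (1 + T) ^ (σ - 1/2) := by positivity
  rw [div_div, div_le_iff₀ (by positivity)] at hkey
  rw [Real.exp_neg, ← div_eq_mul_inv, le_div_iff₀ (Real.exp_pos _)]
  refine hkey.trans ?_
  calc _ ≤ 6 * (3 * (1 + T) ^ (σ - 1/2)) := by gcongr
    _ = _ := by ring

lemma bd_gamma : ∃ C : ℝ, 0 < C ∧ ∀ s : ℂ, 1/2 ≤ s.re → s.re ≤ 3/2 →
    ‖Complex.Gamma s‖ ≤ C * (1 + |s.im|) ^ (s.re - 1/2) * Real.exp (-(π * |s.im| / 2)) := by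
  obtain ⟨C, hC, h⟩ := bd_gamma_pos
  refine ⟨C, hC, fun s h1 h2 => ?_⟩
  rcases le_total 0 s.im with h0 | h0
  · have := h s.re s.im h1 h2 h0
    rw [Complex.re_add_im] at this
    rwa [abs_of_nonneg h0]
  · have := h s.re (-s.im) h1 h2 (by linarith)
    have e : ((s.re : ℂ) + ((-s.im : ℝ) : ℂ) * I) = (starRingEnd ℂ) s := by
      apply Complex.ext <;> simp
    rw [e, Complex.Gamma_conj, Complex.norm_conj] at this
    rwa [abs_of_nonpos h0]

lemma bd_LSeries_bound : ∃ M : ℝ, 1 ≤ M ∧ ∀ f : ℕ → ℂ, (∀ n, ‖f n‖ ≤ 1) → ∀ s : ℂ, 5/4 ≤ s.re →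
    ‖LSeries f s‖ ≤ M := by
  have hsum : Summable (fun n : ℕ => 1 / (n:ℝ) ^ (5/4 : ℝ)) := Real.summable_one_div_nat_rpow.mpr (by norm_num)
  have h0 : 0 ≤ ∑' n : ℕ, 1 / (n:ℝ) ^ (5/4 : ℝ) := tsum_nonneg (fun n => by positivity)
  refine ⟨(∑' n : ℕ, 1 / (n:ℝ) ^ (5/4 : ℝ)) + 1, by linarith, fun f hf s hs => ?_⟩
  refine le_trans (tsum_of_norm_bounded hsum.hasSum ?_) (by linarith)
  intro n
  rw [LSeries.norm_term_eq]
  split_ifs with h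
  · positivity
  · have h1 : (1:ℝ) ≤ n := by exact_mod_cast Nat.one_le_iff_ne_zero.mpr h
    have : (n:ℝ) ^ (5/4:ℝ) ≤ (n:ℝ) ^ s.re := Real.rpow_le_rpow_of_exponent_le h1 hs
    have hn := hf n
    gcongr

lemma bd_moebius_norm (n : ℕ) : ‖((ArithmeticFunction.moebius n : ℤ) : ℂ)‖ ≤ 1 := by
  have := ArithmeticFunction.abs_moebius_le_one (n := n)
  rw [Complex.norm_intCast]
  exact_mod_cast this

lemma bd_zeta_right : ∃ M : ℝ, 1 ≤ M ∧ ∀ s : ℂ, 5/4 ≤ s.re →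
    ‖riemannZeta s‖ ≤ M ∧ 1 ≤ M * ‖riemannZeta s‖ := by
  obtain ⟨M, hM, h⟩ := bd_LSeries_bound
  refine ⟨M, hM, fun s hs => ?_⟩
  have hs1 : 1 < s.re := by linarith
  constructor
  · rw [← LSeries_one_eq_riemannZeta hs1]
    exact h _ (by simp) s hs
  · have h1 := LSeries_one_mul_Lseries_moebius hs1
    rw [LSeries_one_eq_riemannZeta hs1] at h1
    have h2 := h _ bd_moebius_norm s hs
    have h3 := congrArg norm h1
    rw [norm_mul, norm_one] at h3
    calc 1 = ‖riemannZeta s‖ * _ := h3.symm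
      _ ≤ ‖riemannZeta s‖ * M := by gcongr
      _ = _ := mul_comm _ _

lemma bd_cos_norm (z : ℂ) : ‖Complex.cos z‖ ≤ Real.exp |z.im| := by
  rw [Complex.cos, norm_div]
  have h1 : ‖Complex.exp (z * I)‖ ≤ Real.exp |z.im| := by
    rw [Complex.norm_exp]; apply Real.exp_le_exp.mpr; simpa using neg_le_abs z.im
  have h2 : ‖Complex.exp (-z * I)‖ ≤ Real.exp |z.im| := by
    rw [Complex.norm_exp]; apply Real.exp_le_exp.mpr; simpa using le_abs_self z.im
  have := norm_add_le (Complex.exp (z * I)) (Complex.exp (-z * I))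
  rw [Complex.norm_ofNat]
  linarith

lemma bd_FE : ∃ C : ℝ, 0 < C ∧ ∀ s : ℂ, 1/2 ≤ s.re → s.re ≤ 3/2 → 1/5 ≤ ‖s - 1‖ →
    ‖riemannZeta₁ (1 - s)‖ ≤ C * (1 + |s.im|) ^ (s.re - 1/2) * ‖riemannZeta₁ s‖ := by
  obtain ⟨C, hC, hG⟩ := bd_gamma
  refine ⟨12 * C, by positivity, fun s h1 h2 h3 => ?_⟩
  have hs1 : s ≠ 1 := by
    rintro rfl; simp at h3; norm_num at h3
  have hs0 : s ≠ 0 := by rintro rfl; simp at h1; norm_num at h1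
  have h1s : 1 - s ≠ 1 := by intro h; apply hs0; linear_combination -h
  have hnat : ∀ n : ℕ, s ≠ -n := by
    intro n h
    have : s.re = -n := by rw [h]; simp
    have : (0:ℝ) ≤ n := n.cast_nonneg
    linarith
  rw [zeta1_eq_mul h1s, zeta1_eq_mul hs1, riemannZeta_one_sub hnat hs1]
  have a1 : ‖(1 - s - 1 : ℂ)‖ ≤ 6 * ‖s - 1‖ := by
    rw [show (1 - s - 1 : ℂ) = -((s - 1) + 1) by ring, norm_neg]
    have := norm_add_le (s-1) 1
    rw [norm_one] at this
    linarith
  have a2 : ‖(2 * π : ℂ) ^ (-s)‖ ≤ 1 := by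
    rw [show (2 * π : ℂ) = ((2 * π : ℝ) : ℂ) by push_cast; ring,
      Complex.norm_cpow_eq_rpow_re_of_pos (by positivity)]
    apply Real.rpow_le_one_of_one_le_of_nonpos
    · linarith [Real.two_le_pi]
    · simp; linarith
  have a3 := hG s h1 h2
  have a4 : ‖Complex.cos (π * s / 2)‖ ≤ Real.exp (π * |s.im| / 2) := by
    refine (bd_cos_norm _).trans (le_of_eq ?_)
    congr 1
    have : (π * s / 2 : ℂ).im = π * s.im / 2 := by
      simp
    rw [this, abs_div, abs_mul, abs_of_pos pi_pos]; simp
  have a5 : Real.exp (-(π * |s.im| / 2)) * Real.exp (π * |s.im| / 2) = 1 := by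
    rw [← Real.exp_add]; simp
  have p : 0 ≤ (1 + |s.im|) ^ (s.re - 1/2) := by positivity
  simp only [norm_mul, Complex.norm_ofNat]
  calc _ ≤ 6 * ‖s - 1‖ * (2 * 1 * (C * (1 + |s.im|) ^ (s.re - 1/2) * Real.exp (-(π * |s.im| / 2))) * Real.exp (π * |s.im| / 2) * ‖riemannZeta s‖) := by
        gcongr
    _ = 12 * C * (1 + |s.im|) ^ (s.re - 1/2) * (‖s - 1‖ * ‖riemannZeta s‖) * (Real.exp (-(π * |s.im| / 2)) * Real.exp (π * |s.im| / 2)) := by ring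
    _ = _ := by rw [a5, mul_one]

lemma bd_norm_le_strip {z : ℂ} (h1 : -2 ≤ z.re) (h2 : z.re ≤ 2) : ‖z‖ ≤ 2 + |z.im| := by
  refine (Complex.norm_le_abs_re_add_abs_im z).trans ?_
  gcongr
  exact abs_le.mpr ⟨h1, h2⟩

lemma bd_poly_exp (x : ℝ) (hx : 0 ≤ x) : (3 + x) ^ 4 ≤ 81 * Real.exp (4 * x) := by
  have h1 : 3 + x ≤ 3 * Real.exp x := by linarith [Real.add_one_le_exp x]
  calc (3 + x) ^ 4 ≤ (3 * Real.exp x) ^ 4 := by gcongr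
    _ = _ := by rw [mul_pow, ← Real.exp_nat_mul]; norm_num

lemma bd_convex : ∃ C : ℝ, 0 < C ∧ ∀ T : ℝ, ‖riemannZeta₁ (1/2 + T * I)‖ ≤ C * (1 + |T|) ^ (11/8 : ℝ) := by
  obtain ⟨C, hC, hFE⟩ := bd_FE
  obtain ⟨M, hM, hz⟩ := bd_zeta_right
  have hM0 : 0 < M := by linarith
  -- bound on the line 5/4
  have hr : ∀ z : ℂ, z.re = 5/4 → ‖riemannZeta₁ z‖ ≤ M * (1 + |z.im|) := by
    intro z hz1
    have hne : z ≠ 1 := by rintro rfl; norm_num at hz1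
    rw [zeta1_eq_mul hne, norm_mul, mul_comm]
    have a := (hz z hz1.ge).1
    have b : ‖z - 1‖ ≤ 1 + |z.im| := by
      refine (Complex.norm_le_abs_re_add_abs_im _).trans ?_
      simp [hz1]; rw [abs_of_pos (by norm_num)]; norm_num
    gcongr
  have hl : ∀ z : ℂ, z.re = -1/4 → ‖riemannZeta₁ z‖ ≤ C * M * (1 + |z.im|) ^ (7/4 : ℝ) := by
    intro z hz1
    have h5 : (1 - z).re = 5/4 := by simp [hz1]; norm_num
    have a := hFE (1 - z) (by rw [h5]; norm_num) (by rw [h5]; norm_num) (by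
      refine le_trans ?_ (Complex.abs_re_le_norm _)
      rw [Complex.sub_re, h5, Complex.one_re, abs_of_pos (by norm_num)]; norm_num)
    have b := hr (1 - z) h5
    rw [h5, sub_sub_cancel] at a
    have him : |(1 - z).im| = |z.im| := by simp
    rw [him] at a b
    have p : (0:ℝ) < 1 + |z.im| := by positivity
    calc _ ≤ _ := a
      _ ≤ C * (1 + |z.im|) ^ (5/4 - 1/2 : ℝ) * (M * (1 + |z.im|)) := by gcongr
      _ = C * M * ((1 + |z.im|) ^ (5/4 - 1/2 : ℝ) * (1 + |z.im|) ^ (1:ℝ)) := by rw [Real.rpow_one]; ring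
      _ = _ := by rw [← Real.rpow_add p]; norm_num
  set K := 2 * (C * M + M) with hK
  have hK0 : 0 < K := by positivity
  refine ⟨13 * K, by positivity, fun T => ?_⟩
  have hT1 : (0:ℝ) < 1 + |T| := by positivity
  set f : ℂ → ℂ := fun z => riemannZeta₁ z / (z - T * I + 2) ^ 2 / ((1 + |T| : ℝ) : ℂ) ^ (13/8 - z/2) with hf
  have hn : ∀ z : ℂ, ‖f z‖ = ‖riemannZeta₁ z‖ / ‖z - T * I + 2‖ ^ 2 / (1 + |T|) ^ (13/8 - z.re/2) := by
    intro z
    rw [hf]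
    simp only [norm_div, norm_pow]
    rw [Complex.norm_cpow_eq_rpow_re_of_pos hT1]
    congr 2
    simp
  have hden : ∀ z : ℂ, -1/4 ≤ z.re → 1 ≤ ‖z - T * I + 2‖ := by
    intro z hz
    refine le_trans ?_ (Complex.abs_re_le_norm _)
    refine le_trans ?_ (le_abs_self _)
    simp; linarith
  have hden2 : ∀ z : ℂ, |z.im - T| ≤ ‖z - T * I + 2‖ := by
    intro z
    refine le_trans ?_ (Complex.abs_im_le_norm _)
    simp
  have htri : ∀ z : ℂ, 1 + |z.im| ≤ (1 + |T|) * (1 + |z.im - T|) := by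
    intro z
    have := abs_add_le T (z.im - T)
    simp at this
    nlinarith [abs_nonneg T, abs_nonneg (z.im - T)]
  have hsq : ∀ z : ℂ, -1/4 ≤ z.re → (1 + |z.im - T|) ^ 2 ≤ 4 * ‖z - T * I + 2‖ ^ 2 := by
    intro z hz
    have h1 := hden z hz
    have h2 := hden2 z
    have : (1 + |z.im - T|) ≤ 2 * ‖z - T * I + 2‖ := by linarith
    calc _ ≤ (2 * ‖z - T * I + 2‖) ^ 2 := by gcongr
      _ = _ := by ring
  have hkey : ‖f (1/2 + T * I)‖ ≤ 2 * K := by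
    refine bd_vstrip (a := -1/4) (b := 5/4) (by norm_num) ?_ ⟨(11 * (6 * C + 1)) * 81, 4, ?_⟩ ?_ ?_ (by simp; norm_num) (by simp; norm_num)
    · intro z hz1 hz2
      have e1 : z - T * I + 2 ≠ 0 := by
        intro h; have := hden z hz1; rw [h] at this; simp at this; linarith
      have e3 : ((1 + |T| : ℝ) : ℂ) ≠ 0 := by exact_mod_cast hT1.ne'
      have e4 : ((1 + |T| : ℝ) : ℂ) ^ (13/8 - z/2) ≠ 0 := by
        rw [Complex.cpow_ne_zero_iff]; left; exact e3
      have e5 : DifferentiableAt ℂ (fun z : ℂ => ((1 + |T| : ℝ) : ℂ) ^ (13/8 - z/2)) z :=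
        DifferentiableAt.const_cpow (by fun_prop) (Or.inl e3)
      have e6 : DifferentiableAt ℂ (fun z : ℂ => (z - T * I + 2) ^ 2) z := by fun_prop
      rw [hf]
      exact (((differentiable_riemannZeta₁ z)).div e6 (pow_ne_zero 2 e1)).div e5 e4
    · intro z hz1 hz2 hz3
      rw [hn]
      have g1 := hden z hz1
      have g2 : 1 ≤ (1 + |T|) ^ (13/8 - z.re/2) := Real.one_le_rpow (by linarith [abs_nonneg T]) (by linarith)
      have main : ‖riemannZeta₁ z‖ ≤ 11 * (6 * C + 1) * (3 + |z.im|) ^ 4 := by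
        have hbig : 1 ≤ 3 + |z.im| := by linarith [abs_nonneg z.im]
        rcases le_total (1/2) z.re with hh | hh
        · have := zeta1_bound (s := z) (by linarith)
          have h3 := bd_norm_le_strip (z := z) (by linarith) (by linarith)
          calc _ ≤ _ := this
            _ ≤ 11 * (3 + |z.im|) ^ 2 := by gcongr 11 * ?_ ^ 2; linarith
            _ ≤ 11 * (3 + |z.im|) ^ 4 := by gcongr; norm_num
            _ ≤ _ := by
              gcongr; linarith
        · have a := hFE (1 - z) (by simp; linarith) (by simp; linarith) (by
            refine le_trans ?_ (Complex.abs_im_le_norm _)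
            simp; linarith)
          rw [sub_sub_cancel] at a
          have him : |(1 - z).im| = |z.im| := by simp
          rw [him] at a
          have b := zeta1_bound (s := 1 - z) (by simp; linarith)
          have h3 := bd_norm_le_strip (z := 1 - z) (by simp; linarith) (by simp; linarith)
          rw [him] at h3
          have c : (1 + |z.im|) ^ ((1 - z).re - 1/2) ≤ (3 + |z.im|) ^ 2 := by
            calc _ ≤ (1 + |z.im|) ^ (2:ℝ) := by
                  apply Real.rpow_le_rpow_of_exponent_le
                  · linarith [abs_nonneg z.im]
                  · simp; linarith
              _ = (1 + |z.im|) ^ 2 := by norm_cast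
              _ ≤ _ := by gcongr; norm_num
          calc _ ≤ _ := a
            _ ≤ C * (3 + |z.im|) ^ 2 * (11 * (1 + ‖1 - z‖)^2) := by gcongr
            _ ≤ C * (3 + |z.im|) ^ 2 * (11 * (3 + |z.im|)^2) := by gcongr C * _ * (11 * ?_ ^ 2); linarith
            _ = 11 * C * (3 + |z.im|) ^ 4 := by ring
            _ ≤ _ := by
              gcongr; nlinarith
      have h4 := bd_poly_exp |z.im| (abs_nonneg _)
      calc _ ≤ ‖riemannZeta₁ z‖ / ‖z - T * I + 2‖ ^ 2 := div_le_self (by positivity) g2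
        _ ≤ ‖riemannZeta₁ z‖ := div_le_self (by positivity) (one_le_pow₀ g1)
        _ ≤ _ := main
        _ ≤ 11 * (6 * C + 1) * (81 * Real.exp (4 * |z.im|)) := by gcongr
        _ = _ := by ring
    · intro z hz1
      rw [hn, hz1, div_div, show (13/8 - -1/4/2 : ℝ) = 7/4 by norm_num, div_le_iff₀ (by have := hden z hz1.ge; positivity)]
      have q : (1 + |z.im - T|) ^ (7/4 : ℝ) ≤ 4 * ‖z - T * I + 2‖ ^ 2 := by
        refine le_trans ?_ (hsq z hz1.ge)
        rw [← Real.rpow_natCast]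
        apply Real.rpow_le_rpow_of_exponent_le
        · linarith [abs_nonneg (z.im - T)]
        · norm_num
      calc _ ≤ _ := hl z hz1
        _ ≤ C * M * ((1 + |T|) * (1 + |z.im - T|)) ^ (7/4 : ℝ) := by gcongr; exact htri z
        _ = C * M * ((1 + |T|) ^ (7/4 : ℝ) * (1 + |z.im - T|) ^ (7/4 : ℝ)) := by
            rw [Real.mul_rpow (by positivity) (by positivity)]
        _ ≤ C * M * ((1 + |T|) ^ (7/4 : ℝ) * (4 * ‖z - T * I + 2‖ ^ 2)) := by gcongr
        _ = (4 * (C * M)) * (‖z - T * I + 2‖ ^ 2 * (1 + |T|) ^ (7/4 : ℝ)) := by ring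
        _ ≤ _ := by
          refine mul_le_mul_of_nonneg_right ?_ (by positivity); rw [hK]; nlinarith
    · intro z hz1
      rw [hn, hz1, div_div, show (13/8 - 5/4/2 : ℝ) = 1 by norm_num, Real.rpow_one, div_le_iff₀ (by have := hden z (by linarith); positivity)]
      have q : (1 + |z.im - T|) ≤ 4 * ‖z - T * I + 2‖ ^ 2 := by
        refine le_trans ?_ (hsq z (by linarith))
        exact le_self_pow₀ (by linarith [abs_nonneg (z.im - T)]) (by norm_num)
      calc _ ≤ _ := hr z hz1
        _ ≤ M * ((1 + |T|) * (1 + |z.im - T|)) := by gcongr; exact htri z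
        _ ≤ M * ((1 + |T|) * (4 * ‖z - T * I + 2‖ ^ 2)) := by gcongr
        _ = 4 * M * (‖z - T * I + 2‖ ^ 2 * (1 + |T|)) := by ring
        _ ≤ _ := by
          refine mul_le_mul_of_nonneg_right ?_ (by positivity); rw [hK]; nlinarith [mul_pos hC hM0]
  rw [hn] at hkey
  have r1 : ‖(1/2 + T * I : ℂ) - T * I + 2‖ = 5/2 := by
    rw [show (1/2 + T * I : ℂ) - T * I + 2 = ((5/2 : ℝ) : ℂ) by push_cast; ring, Complex.norm_real]
    norm_num
  have hre : (1/2 + T * I : ℂ).re = 1/2 := by simp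
  rw [r1, hre, show (13/8 - 1/2/2 : ℝ) = 11/8 by norm_num, div_div, div_le_iff₀ (by positivity)] at hkey
  refine hkey.trans ?_
  have : (0:ℝ) ≤ K * (1 + |T|) ^ (11/8 : ℝ) := by positivity
  nlinarith

/-- point on the critical line -/
noncomputable def bdS (t : ℝ) : ℂ := 1 / 2 + t * Complex.I

noncomputable def bdW (t : ℝ) : ℝ := (1 + |t|) ^ (-(5/8) : ℝ)

/-- generators -/
noncomputable def bdE (n : ℕ) (t : ℝ) : ℂ := riemannZeta (bdS t) * ((n : ℂ) + 1) ^ (-(bdS t)) / bdS t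

lemma bdS_re (t : ℝ) : (bdS t).re = 1/2 := by simp [bdS]
lemma bdS_im (t : ℝ) : (bdS t).im = t := by simp [bdS]

lemma bdS_norm_sq (t : ℝ) : ‖bdS t‖ ^ 2 = 1/4 + t ^ 2 := by
  rw [Complex.sq_norm, Complex.normSq_apply, bdS_re, bdS_im]; ring

lemma bdS_ne_zero (t : ℝ) : bdS t ≠ 0 := by
  intro h; have := bdS_re t; rw [h] at this; norm_num at this

lemma bdS_ne_one (t : ℝ) : bdS t ≠ 1 := by
  intro h; have := bdS_re t; rw [h] at this; norm_num at this

lemma bdS_norm_sub_one (t : ℝ) : ‖bdS t - 1‖ = ‖bdS t‖ := by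
  rw [← sq_eq_sq₀ (norm_nonneg _) (norm_nonneg _), Complex.sq_norm, Complex.sq_norm, Complex.normSq_apply, Complex.normSq_apply]
  simp [bdS_re, bdS_im]; norm_num

lemma bdS_lower (t : ℝ) : 1 + |t| ≤ 3 * ‖bdS t‖ := by
  rw [← sq_le_sq₀ (by positivity) (by positivity)]
  rw [mul_pow, bdS_norm_sq, ← sq_abs t]
  nlinarith [sq_nonneg (|t| - 1/8)]

lemma bdS_upper (t : ℝ) : ‖bdS t‖ ≤ 1 + |t| := by
  refine (Complex.norm_le_abs_re_add_abs_im _).trans ?_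
  rw [bdS_re, bdS_im, abs_of_pos (by norm_num)]; linarith

lemma bdS_cont : Continuous bdS := by unfold bdS; fun_prop

lemma bdW_pos (t : ℝ) : 0 < bdW t := by unfold bdW; positivity

lemma bdW_memLp : MemLp bdW 2 volume := by
  have hc : Continuous bdW := by
    unfold bdW
    refine Continuous.rpow_const (by fun_prop) (fun t => Or.inl (by positivity))
  rw [memLp_two_iff_integrable_sq hc.aestronglyMeasurable]
  have := integrable_one_add_norm (E := ℝ) (μ := volume) (r := 5/4) (by simp; norm_num)
  refine this.congr (Eventually.of_forall fun t => ?_)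
  simp only [bdW, Real.norm_eq_abs]
  rw [← Real.rpow_natCast, ← Real.rpow_mul (by positivity)]; norm_num

lemma bd_memLp {g : ℝ → ℂ} (hg : AEStronglyMeasurable g volume) {C : ℝ} (h : ∀ t, ‖g t‖ ≤ C * bdW t) :
    MemLp g 2 volume := by
  refine (bdW_memLp.const_mul C).mono' hg (Eventually.of_forall h)

lemma bdZ_cont : Continuous (fun t => riemannZeta (bdS t)) := by
  rw [continuous_iff_continuousAt]
  intro t
  exact (differentiableAt_riemannZeta (bdS_ne_one t)).continuousAt.comp bdS_cont.continuousAt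

lemma bdW_ge {C : ℝ} {x t : ℝ} (hC : 0 ≤ C) (hx : x ≤ C * (1 + |t|) ^ (11/8:ℝ)) : x / ‖bdS t‖ ^ 2 ≤ 9 * C * bdW t := by
  have h := bdS_lower t
  have p : (0:ℝ) < 1 + |t| := by positivity
  have hp : 0 < ‖bdS t‖ := by linarith
  rw [div_le_iff₀ (by positivity)]
  refine hx.trans ?_
  have h2 : (1 + |t|) ^ 2 ≤ 9 * ‖bdS t‖ ^ 2 := by
    calc _ ≤ (3 * ‖bdS t‖) ^ 2 := by gcongr
      _ = _ := by ring
  have h3 : (1 + |t|) ^ (11/8:ℝ) = bdW t * (1 + |t|) ^ 2 := by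
    rw [bdW, ← Real.rpow_natCast, ← Real.rpow_add p]; norm_num
  rw [h3]
  have := bdW_pos t
  calc C * (bdW t * (1 + |t|) ^ 2) ≤ C * (bdW t * (9 * ‖bdS t‖ ^ 2)) := by gcongr
    _ = _ := by ring

lemma bd_zeta_div : ∃ C : ℝ, 0 < C ∧ ∀ t, ‖riemannZeta (bdS t) / bdS t‖ ≤ C * bdW t := by
  obtain ⟨C, hC, h⟩ := bd_convex
  refine ⟨9 * C, by positivity, fun t => ?_⟩
  have h1 := bdW_ge hC.le (h t)
  refine le_trans (le_of_eq ?_) h1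
  change _ = ‖riemannZeta₁ (bdS t)‖ / _
  rw [zeta1_eq_mul (bdS_ne_one t), norm_mul, bdS_norm_sub_one, norm_div]
  have : ‖bdS t‖ ≠ 0 := norm_ne_zero_iff.mpr (bdS_ne_zero t)
  field_simp

lemma bd_f0_bound (t : ℝ) : ‖1 / bdS t‖ ≤ 9 * bdW t := by
  have p : (0:ℝ) < 1 + |t| := by positivity
  have hx : ‖bdS t‖ ≤ 1 * (1 + |t|) ^ (11/8:ℝ) := by
    rw [one_mul]
    refine (bdS_upper t).trans ?_
    exact Real.self_le_rpow_of_one_le (by linarith [abs_nonneg t]) (by norm_num)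
  have := bdW_ge zero_le_one hx
  rw [mul_one] at this
  refine le_trans (le_of_eq ?_) this
  have : ‖bdS t‖ ≠ 0 := norm_ne_zero_iff.mpr (bdS_ne_zero t)
  rw [norm_div, norm_one]
  field_simp

lemma bd_f0_memLp : MemLp (fun t => 1 / bdS t) 2 volume := by
  refine bd_memLp (C := 9) (Continuous.aestronglyMeasurable ?_) bd_f0_bound
  exact continuous_const.div bdS_cont bdS_ne_zero

lemma bd_cpow_norm_le (n : ℕ) {s : ℂ} (hs : 0 ≤ s.re) : ‖((n : ℂ) + 1) ^ (-s)‖ ≤ 1 := by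
  rw [show (n : ℂ) + 1 = (((n:ℝ) + 1 : ℝ) : ℂ) by push_cast; ring,
    Complex.norm_cpow_eq_rpow_re_of_pos (by positivity)]
  apply Real.rpow_le_one_of_one_le_of_nonpos
  · linarith [Nat.cast_nonneg (α := ℝ) n]
  · simp; linarith

lemma bd_cpow_diff (n : ℕ) : Differentiable ℂ (fun s : ℂ => ((n : ℂ) + 1) ^ (-s)) := by
  intro s
  exact DifferentiableAt.const_cpow (by fun_prop) (Or.inl (Nat.cast_add_one_ne_zero n))

lemma bdE_cont (n : ℕ) : Continuous (bdE n) := by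
  refine (bdZ_cont.mul ?_).div bdS_cont bdS_ne_zero
  exact (bd_cpow_diff n).continuous.comp bdS_cont

lemma bdE_memLp (n : ℕ) : MemLp (bdE n) 2 volume := by
  obtain ⟨C, hC, h⟩ := bd_zeta_div
  refine bd_memLp (C := C) (bdE_cont n).aestronglyMeasurable (fun t => ?_)
  rw [bdE, mul_div_right_comm, norm_mul]
  calc _ ≤ ‖riemannZeta (bdS t) / bdS t‖ * 1 := by
        gcongr; exact bd_cpow_norm_le n (by rw [bdS_re]; norm_num)
    _ ≤ _ := by rw [mul_one]; exact h t

lemma bd_integrand {N : ℕ} (a : Fin N → ℂ) (t : ℝ) :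
    ‖1 - riemannZeta (1 / 2 + t * Complex.I) *
        ∑ n : Fin N, a n * ((n : ℂ) + 1) ^ (-(1 / 2 + t * Complex.I))‖ ^ 2
      / (1 / 4 + t ^ 2) = ‖1 / bdS t - ∑ n : Fin N, a n * bdE n t‖ ^ 2 := by
  rw [← bdS_norm_sq, ← div_pow, ← norm_div]
  congr 2
  change (1 - riemannZeta (bdS t) * ∑ n : Fin N, a n * ((n : ℂ) + 1) ^ (-(bdS t))) / bdS t = _
  rw [sub_div, Finset.mul_sum, Finset.sum_div]
  congr 1
  refine Finset.sum_congr rfl fun n _ => ?_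
  rw [bdE]; ring

lemma bd_comb_memLp {N : ℕ} (a : Fin N → ℂ) : MemLp (fun t => 1 / bdS t - ∑ n : Fin N, a n * bdE n t) 2 volume := by
  refine bd_f0_memLp.sub (memLp_finsetSum _ fun n _ => (bdE_memLp n).const_mul (a n))

lemma bd_comb_integrable {N : ℕ} (a : Fin N → ℂ) :
    Integrable (fun t => ‖1 / bdS t - ∑ n : Fin N, a n * bdE n t‖ ^ 2) volume :=
  (memLp_two_iff_integrable_sq_norm (bd_comb_memLp a).1).mp (bd_comb_memLp a)

lemma bd_kernel_integrable {σ : ℝ} (hσ : 0 < σ) (γ : ℝ) : Integrable (fun t : ℝ => (σ ^ 2 + (t - γ) ^ 2)⁻¹) := by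
  have h1 := (integrable_inv_one_add_sq.comp_div hσ.ne').comp_sub_right γ
  refine (h1.const_mul (σ ^ 2)⁻¹).congr (Eventually.of_forall fun t => ?_)
  simp only
  rw [← mul_inv]
  congr 1
  field_simp

lemma bd_poisson {G : ℂ → ℂ} (hd : DifferentiableOn ℂ G {s | 1/2 ≤ s.re}) {B : ℝ}
    (hb : ∀ s : ℂ, 1/2 ≤ s.re → ‖G s‖ ≤ B) {ρ : ℂ} (hρ : 1/2 < ρ.re)
    (hi : Integrable (fun t : ℝ => ‖G (bdS t)‖ ^ 2)) :
    ‖G ρ‖ ^ 2 * ((∫ t : ℝ, ((ρ.re - 1/2) ^ 2 + (t - ρ.im) ^ 2)⁻¹) * (ρ.re - 1/2) ^ 2) ≤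
      ∫ t : ℝ, ‖G (bdS t)‖ ^ 2 := by
  set σ := ρ.re - 1/2 with hσd
  have hσ : 0 < σ := by rw [hσd]; linarith
  set γ := ρ.im with hγ
  have hB : 0 ≤ B := (norm_nonneg _).trans (hb ρ hρ.le)
  set ρ' : ℂ := ⟨1/2 - σ, γ⟩ with hρ'
  have hrhone : ∀ s : ℂ, 1/2 ≤ s.re → s - ρ' ≠ 0 := by
    intro s hs h
    have := congrArg Complex.re h
    simp [hρ'] at this
    linarith
  set Q : ℂ → ℂ := fun s => dslope G ρ s / (s - ρ') with hQ
  have hQd : DifferentiableOn ℂ Q {s | 1/2 ≤ s.re} := by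
    refine DifferentiableOn.div ?_ (by fun_prop) (fun s hs => hrhone s hs)
    rw [Complex.differentiableOn_dslope]
    · exact hd
    · have : {s : ℂ | 1/2 < s.re} ∈ nhds ρ := (isOpen_lt continuous_const Complex.continuous_re).mem_nhds hρ
      exact mem_of_superset this (fun s (hs : 1/2 < s.re) => hs.le)
  have hcmp : ∀ s : ℂ, 1/2 ≤ s.re → ‖s - ρ‖ ≤ ‖s - ρ'‖ := by
    intro s hs
    rw [← sq_le_sq₀ (by positivity) (by positivity), Complex.sq_norm, Complex.sq_norm, Complex.normSq_apply, Complex.normSq_apply]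
    have e : ρ.re = σ + 1/2 := by rw [hσd]; ring
    simp only [hρ', Complex.sub_re, Complex.sub_im, e, ← hγ]
    nlinarith
  have hQeq : ∀ s : ℂ, s ≠ ρ → Q s = (G s - G ρ) / ((s - ρ) * (s - ρ')) := by
    intro s hs
    simp only [hQ]
    rw [dslope_of_ne _ hs, slope_def_field]
    rw [div_div]
  have hQb : ∀ s : ℂ, 1/2 ≤ s.re → ∀ r : ℝ, 0 < r → r ≤ ‖s - ρ‖ → ‖Q s‖ ≤ 2 * B / r ^ 2 := by
    intro s hs r hr h
    have hne : s ≠ ρ := by rintro rfl; simp at h; linarith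
    rw [hQeq s hne, norm_div, norm_mul, sq]
    have := hcmp s hs
    have h3 : ‖G s - G ρ‖ ≤ 2 * B := by
      refine (norm_sub_le _ _).trans ?_
      linarith [hb s hs, hb ρ hρ.le]
    gcongr
    linarith
  -- line values
  have hline : ∀ t : ℝ, Q (bdS t) = -((G (bdS t) - G ρ) * ((σ ^ 2 + (t - γ) ^ 2)⁻¹ : ℝ)) := by
    intro t
    have hne : bdS t ≠ ρ := by
      intro h; have := bdS_re t; rw [h] at this; linarith
    rw [hQeq _ hne]
    have : (bdS t - ρ) * (bdS t - ρ') = -((σ ^ 2 + (t - γ) ^ 2 : ℝ) : ℂ) := by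
      have e : ρ.re = σ + 1/2 := by rw [hσd]; ring
      apply Complex.ext
      · rw [Complex.neg_re, Complex.ofReal_re, Complex.mul_re]
        simp [hρ', bdS_re, bdS_im, e, ← hγ]; ring
      · rw [Complex.neg_im, Complex.ofReal_im, Complex.mul_im]
        simp [hρ', bdS_re, bdS_im, e, ← hγ]; ring
    rw [this, div_neg]
    push_cast
    rw [div_eq_mul_inv]
  have hGc : Continuous (fun t => G (bdS t)) := by
    exact hd.continuousOn.comp_continuous bdS_cont (fun t => (bdS_re t).ge)
  have hk := bd_kernel_integrable hσ γ
  have hkc : Integrable (fun t : ℝ => (((σ ^ 2 + (t - γ) ^ 2)⁻¹ : ℝ) : ℂ)) := hk.ofReal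
  have hGk : Integrable (fun t : ℝ => G (bdS t) * ((σ ^ 2 + (t - γ) ^ 2)⁻¹ : ℝ)) :=
    hkc.bdd_mul (c := B) hGc.aestronglyMeasurable (Eventually.of_forall fun t => hb _ (bdS_re t).ge)
  have hQi : Integrable (fun t => Q (bdS t)) := by
    simp_rw [hline, sub_mul]
    exact (hGk.sub (hkc.const_mul _)).neg
  have hrect : ∀ R : ℝ, 2 * σ < R → ‖∫ y in (γ - R)..(γ + R), Q (bdS y)‖ ≤ 20 * B / R := by
    intro R hR
    have hR0 : 0 < R := by linarith
    have key := Complex.integral_boundary_rect_eq_zero_of_differentiableOn Q ⟨1/2, γ - R⟩ ⟨1/2 + R, γ + R⟩ (by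
      refine hQd.mono ?_
      intro s hs
      rw [Complex.mem_reProdIm] at hs
      have := hs.1
      simp only [Set.uIcc_of_le (show (1/2:ℝ) ≤ 1/2 + R by linarith)] at this
      exact this.1)
    simp only at key
    have b1 : ‖∫ x in (1/2:ℝ)..(1/2 + R), Q (x + (γ - R : ℝ) * I)‖ ≤ 2 * B / R ^ 2 * |1/2 + R - 1/2| := by
      refine intervalIntegral.norm_integral_le_of_norm_le_const fun x hx => ?_
      rw [Set.uIoc_of_le (by linarith)] at hx
      refine hQb _ (by simpa using hx.1.le) R hR0 ?_
      refine le_trans ?_ (Complex.abs_im_le_norm _)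
      simp [← hγ, abs_of_pos hR0]
    have b2 : ‖∫ x in (1/2:ℝ)..(1/2 + R), Q (x + (γ + R : ℝ) * I)‖ ≤ 2 * B / R ^ 2 * |1/2 + R - 1/2| := by
      refine intervalIntegral.norm_integral_le_of_norm_le_const fun x hx => ?_
      rw [Set.uIoc_of_le (by linarith)] at hx
      refine hQb _ (by simpa using hx.1.le) R hR0 ?_
      refine le_trans ?_ (Complex.abs_im_le_norm _)
      simp [← hγ, abs_of_pos hR0]
    have b3 : ‖∫ y in (γ - R)..(γ + R), Q ((1/2 + R : ℝ) + y * I)‖ ≤ 2 * B / (R/2) ^ 2 * |γ + R - (γ - R)| := by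
      refine intervalIntegral.norm_integral_le_of_norm_le_const fun x hx => ?_
      refine hQb _ (by simp; linarith) (R/2) (by linarith) ?_
      refine le_trans ?_ (Complex.abs_re_le_norm _)
      refine le_trans ?_ (le_abs_self _)
      have e : ρ.re = σ + 1/2 := by rw [hσd]; ring
      simp [e]; linarith
    have e4 : ∫ y in (γ - R)..(γ + R), Q (bdS y) = ∫ y in (γ - R)..(γ + R), Q ((1/2 : ℝ) + y * I) := by
      congr 1; ext y; simp [bdS]
    rw [e4]
    rw [show |1/2 + R - 1/2| = R by rw [add_sub_cancel_left, abs_of_pos hR0]] at b1 b2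
    rw [show |γ + R - (γ - R)| = 2 * R by rw [show γ + R - (γ - R) = 2 * R by ring, abs_of_pos (by linarith)]] at b3
    have h5 : I • ∫ y in (γ - R)..(γ + R), Q ((1/2 : ℝ) + y * I) =
        (∫ x in (1/2:ℝ)..(1/2 + R), Q (x + (γ - R : ℝ) * I)) - (∫ x in (1/2:ℝ)..(1/2 + R), Q (x + (γ + R : ℝ) * I)) +
        I • ∫ y in (γ - R)..(γ + R), Q ((1/2 + R : ℝ) + y * I) := by
      linear_combination -key
    have h6 := congrArg norm h5
    rw [norm_smul, Complex.norm_I, one_mul] at h6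
    rw [h6]
    refine (norm_add_le _ _).trans ?_
    rw [norm_smul, Complex.norm_I, one_mul]
    refine (add_le_add (norm_sub_le _ _) le_rfl).trans ?_
    refine (add_le_add (add_le_add b1 b2) b3).trans (le_of_eq ?_)
    field_simp
    ring
  have hzero : ∫ t, Q (bdS t) = 0 := by
    have t1 : Tendsto (fun R : ℝ => ∫ y in (γ - R)..(γ + R), Q (bdS y)) atTop (nhds (∫ t, Q (bdS t))) :=
      intervalIntegral_tendsto_integral hQi (tendsto_atBot_add_const_left _ _ tendsto_neg_atTop_atBot)
        (tendsto_atTop_add_const_left _ _ tendsto_id)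
    have t2 : Tendsto (fun R : ℝ => ∫ y in (γ - R)..(γ + R), Q (bdS y)) atTop (nhds 0) := by
      refine squeeze_zero_norm' (a := fun R => 20 * B / R) ?_ (tendsto_const_nhds.div_atTop tendsto_id)
      filter_upwards [eventually_gt_atTop (2 * σ)] with R hR using hrect R hR
    exact tendsto_nhds_unique t1 t2
  set P := ∫ t : ℝ, (σ ^ 2 + (t - γ) ^ 2)⁻¹ with hP
  have hP0 : 0 ≤ P := integral_nonneg fun t => by positivity
  have hmain : G ρ * P = ∫ t, G (bdS t) * ((σ ^ 2 + (t - γ) ^ 2)⁻¹ : ℝ) := by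
    simp_rw [hline, sub_mul] at hzero
    rw [integral_neg, integral_sub hGk (hkc.const_mul _), integral_const_mul, integral_complex_ofReal, neg_eq_zero, sub_eq_zero] at hzero
    exact hzero.symm
  by_cases hG0 : G ρ = 0
  · rw [hG0]; simp; exact integral_nonneg fun t => by positivity
  have hg : 0 < ‖G ρ‖ := norm_pos_iff.mpr hG0
  have h7 : ‖G ρ‖ * P ≤ ∫ t, (‖G ρ‖ / 2 * (σ ^ 2 + (t - γ) ^ 2)⁻¹ + 1 / (2 * ‖G ρ‖ * σ ^ 2) * ‖G (bdS t)‖ ^ 2) := by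
    have : ‖G ρ‖ * P = ‖G ρ * P‖ := by rw [norm_mul, Complex.norm_real, Real.norm_of_nonneg hP0]
    rw [this, hmain]
    refine norm_integral_le_of_norm_le ((hk.const_mul _).add (hi.const_mul _)) (Eventually.of_forall fun t => ?_)
    rw [norm_mul, Complex.norm_real, Real.norm_of_nonneg (by positivity)]
    set k := (σ ^ 2 + (t - γ) ^ 2)⁻¹ with hkk
    have hk0 : 0 < k := by positivity
    have hk1 : k * σ ^ 2 ≤ 1 := by
      rw [hkk, inv_mul_le_iff₀ (by positivity)]; nlinarith [sq_nonneg (t - γ)]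
    set x := ‖G (bdS t)‖
    set g := ‖G ρ‖
    have : 1 / (2 * g * σ ^ 2) * x ^ 2 ≥ k / (2 * g) * x ^ 2 := by
      refine mul_le_mul_of_nonneg_right ?_ (sq_nonneg x)
      rw [div_le_div_iff₀ (by positivity) (by positivity)]
      nlinarith
    have h8 : g / 2 * k + k / (2 * g) * x ^ 2 - x * k = k / (2 * g) * (g - x) ^ 2 := by
      field_simp; ring
    have : 0 ≤ k / (2 * g) * (g - x) ^ 2 := by positivity
    linarith
  rw [integral_add (hk.const_mul _) (hi.const_mul _), integral_const_mul, integral_const_mul, ← hP] at h7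
  set J := ∫ t : ℝ, ‖G (bdS t)‖ ^ 2
  have h9 : ‖G ρ‖ / 2 * P ≤ 1 / (2 * ‖G ρ‖ * σ ^ 2) * J := by linarith
  have h10 : (2 * ‖G ρ‖ * σ ^ 2) * (‖G ρ‖ / 2 * P) ≤ (2 * ‖G ρ‖ * σ ^ 2) * (1 / (2 * ‖G ρ‖ * σ ^ 2) * J) := by gcongr
  have h11 : (2 * ‖G ρ‖ * σ ^ 2) * (1 / (2 * ‖G ρ‖ * σ ^ 2) * J) = J := by field_simp
  rw [h11] at h10
  linarith

lemma bd_zero_lower {ρ : ℂ} (h0 : riemannZeta ρ = 0) (h1 : 1/2 < ρ.re) (h2 : ρ.re < 1) :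
    ∃ c : ℝ, 0 < c ∧ ∀ (N : ℕ) (a : Fin N → ℂ), c ≤ ∫ t : ℝ, ‖1 / bdS t - ∑ n : Fin N, a n * bdE n t‖ ^ 2 := by
  have hρ0 : ρ ≠ 0 := by rintro rfl; simp at h1; linarith
  have hρ1 : ρ ≠ 1 := by rintro rfl; simp at h2
  set σ := ρ.re - 1/2 with hσ
  have hσ0 : 0 < σ := by rw [hσ]; linarith
  have hP : 0 < ∫ t : ℝ, (σ ^ 2 + (t - ρ.im) ^ 2)⁻¹ := by
    rw [integral_pos_iff_support_of_nonneg (fun t => by positivity) (bd_kernel_integrable hσ0 _)]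
    have : Function.support (fun t : ℝ => (σ ^ 2 + (t - ρ.im) ^ 2)⁻¹) = Set.univ := by
      ext t; simp only [Function.mem_support, Set.mem_univ, iff_true]; positivity
    rw [this]; simp
  have hn : 0 < ‖(ρ - 1) / ρ ^ 2‖ := norm_pos_iff.mpr (div_ne_zero (sub_ne_zero.mpr hρ1) (pow_ne_zero _ hρ0))
  refine ⟨‖(ρ - 1) / ρ ^ 2‖ ^ 2 * ((∫ t : ℝ, (σ ^ 2 + (t - ρ.im) ^ 2)⁻¹) * σ ^ 2), by positivity, fun N a => ?_⟩
  set D : ℂ → ℂ := fun s => ∑ n : Fin N, a n * ((n : ℂ) + 1) ^ (-s) with hD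
  set G : ℂ → ℂ := fun s => ((s - 1) - riemannZeta₁ s * D s) / s ^ 2 with hG
  have hDd : Differentiable ℂ D := by
    refine Differentiable.fun_sum fun n _ => ?_
    exact (bd_cpow_diff n).const_mul _
  have hs0 : ∀ s : ℂ, 1/2 ≤ s.re → 1/2 ≤ ‖s‖ := fun s hs => hs.trans ((le_abs_self _).trans (Complex.abs_re_le_norm s))
  have hGd : DifferentiableOn ℂ G {s | 1/2 ≤ s.re} := by
    have e1 : Differentiable ℂ (fun s : ℂ => (s - 1) - riemannZeta₁ s * D s) :=
      (differentiable_id.sub_const 1).sub (differentiable_riemannZeta₁.mul hDd)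
    refine e1.differentiableOn.div (by fun_prop) (fun s hs => ?_)
    have := hs0 s hs
    exact pow_ne_zero _ (norm_pos_iff.mp (by linarith))
  have hGb : ∀ s : ℂ, 1/2 ≤ s.re → ‖G s‖ ≤ 6 + 99 * ∑ n, ‖a n‖ := by
    intro s hs
    have g0 := hs0 s hs
    have g1 : ‖D s‖ ≤ ∑ n, ‖a n‖ := by
      refine norm_sum_le_of_le _ fun n _ => ?_
      rw [norm_mul]
      calc _ ≤ ‖a n‖ * 1 := by gcongr; exact bd_cpow_norm_le n (by linarith)
        _ = _ := mul_one _
    have g2 := zeta1_bound (s := s) (by linarith)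
    have g3 : 1 + ‖s‖ ≤ 3 * ‖s‖ := by linarith
    have g4 : ‖s - 1‖ ≤ 6 * ‖s‖ ^ 2 := by
      have := norm_sub_le s 1
      rw [norm_one] at this
      nlinarith
    simp only [hG]
    rw [norm_div, norm_pow, div_le_iff₀ (by positivity)]
    refine (norm_sub_le _ _).trans ?_
    rw [norm_mul]
    have A0 : 0 ≤ ∑ n, ‖a n‖ := Finset.sum_nonneg fun n _ => norm_nonneg _
    calc _ ≤ 6 * ‖s‖ ^ 2 + (11 * (3 * ‖s‖) ^ 2) * ∑ n, ‖a n‖ := by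
          gcongr
          refine g2.trans ?_
          gcongr
      _ = _ := by ring
  have hline : ∀ t, ‖G (bdS t)‖ = ‖1 / bdS t - ∑ n : Fin N, a n * bdE n t‖ := by
    intro t
    have e1 : 1 / bdS t - ∑ n : Fin N, a n * bdE n t = (1 - riemannZeta (bdS t) * D (bdS t)) / bdS t := by
      rw [sub_div, hD]
      simp only
      rw [Finset.mul_sum, Finset.sum_div]
      congr 1
      refine Finset.sum_congr rfl fun n _ => ?_
      rw [bdE]; ring
    rw [e1]
    simp only [hG]
    rw [zeta1_eq_mul (bdS_ne_one t), show (bdS t - 1) - (bdS t - 1) * riemannZeta (bdS t) * D (bdS t) = (bdS t - 1) * (1 - riemannZeta (bdS t) * D (bdS t)) by ring,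
      norm_div, norm_mul, bdS_norm_sub_one, norm_div, norm_pow]
    have : ‖bdS t‖ ≠ 0 := norm_ne_zero_iff.mpr (bdS_ne_zero t)
    field_simp
  have hi := bd_comb_integrable a
  simp_rw [← hline] at hi ⊢
  have key := bd_poisson hGd hGb h1 hi
  have hGρ : G ρ = (ρ - 1) / ρ ^ 2 := by
    simp only [hG]; rw [zeta1_eq_mul hρ1, h0]; simp
  rw [hGρ] at key
  exact key

lemma bd_dNsq_eq (N : ℕ) : dNsq N = ⨅ a : Fin N → ℂ, (1 / (2 * Real.pi)) * ∫ t : ℝ, ‖1 / bdS t - ∑ n : Fin N, a n * bdE n t‖ ^ 2 := by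
  unfold dNsq
  simp_rw [bd_integrand]

lemma bd_converse (h : Tendsto (fun N : ℕ => Real.sqrt (dNsq N)) atTop (nhds 0)) :
    ∀ s : ℂ, riemannZeta s = 0 → 0 < s.re → s.re < 1 → s.re = 1 / 2 := by
  have main : ∀ s : ℂ, riemannZeta s = 0 → s.re < 1 → s.re ≤ 1/2 := by
    intro s h0 h1
    by_contra! h2
    obtain ⟨c, hc, hcc⟩ := bd_zero_lower h0 h2 h1
    have h3 : ∀ N, (1 / (2 * Real.pi)) * c ≤ dNsq N := by
      intro N
      rw [bd_dNsq_eq]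
      refine le_ciInf fun a => ?_
      have := hcc N a
      gcongr
    have h4 : Real.sqrt ((1 / (2 * Real.pi)) * c) ≤ 0 := by
      refine ge_of_tendsto h (Eventually.of_forall fun N => Real.sqrt_le_sqrt (h3 N))
    have : 0 < Real.sqrt ((1 / (2 * Real.pi)) * c) := Real.sqrt_pos.mpr (by positivity)
    linarith
  intro s h0 h1 h2
  refine le_antisymm (main s h0 h2) ?_
  have hz : riemannZeta (1 - s) = 0 := by
    have hs1 : s ≠ 1 := by rintro rfl; simp at h2
    have hn : ∀ n : ℕ, s ≠ -n := by
      intro n hh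
      have : s.re = -n := by rw [hh]; simp
      have : (0:ℝ) ≤ n := n.cast_nonneg
      linarith
    rw [riemannZeta_one_sub hn hs1, h0, mul_zero]
  have := main (1 - s) hz (by simp; linarith)
  simp at this
  linarith

/-- RH in the form used by the statement -/
def bdRH : Prop := ∀ s : ℂ, riemannZeta s = 0 → 0 < s.re → s.re < 1 → s.re = 1 / 2

lemma bd_Z_ne (hRH : bdRH) {s : ℂ} (hs : 1/2 < s.re) : riemannZeta₁ s ≠ 0 := by
  by_cases h1 : s = 1
  · rw [h1, riemannZeta₁_one]; exact one_ne_zero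
  rw [zeta1_eq_mul h1]
  refine mul_ne_zero (sub_ne_zero.mpr h1) ?_
  rcases lt_or_ge s.re 1 with h | h
  · intro h0
    have := hRH s h0 (by linarith) h
    linarith
  · exact riemannZeta_ne_zero_of_one_le_re h

lemma bd_log_ge (t : ℝ) : 1 ≤ Real.log (3 + |t|) := by
  rw [Real.le_log_iff_exp_le (by positivity)]
  linarith [Real.exp_one_lt_d9, abs_nonneg t]

lemma bd_log_exists (hRH : bdRH) (t : ℝ) : ∃ L : ℂ → ℂ, DifferentiableOn ℂ L (Metric.ball (2 + t * I) (3/2)) ∧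
    L (2 + t * I) = 0 ∧ ∀ s ∈ Metric.ball (2 + t * I : ℂ) (3/2), riemannZeta₁ s = riemannZeta₁ (2 + t * I) * Complex.exp (L s) := by
  set c : ℂ := 2 + t * I with hc
  have hre : ∀ s ∈ Metric.ball c (3/2), 1/2 < s.re := by
    intro s hs
    rw [mem_ball_iff_norm] at hs
    have h1 := (abs_le.mp (Complex.abs_re_le_norm (s - c))).1
    simp [hc] at h1
    rw [← hc] at h1
    linarith
  have hne : ∀ s ∈ Metric.ball c (3/2), riemannZeta₁ s ≠ 0 := fun s hs => bd_Z_ne hRH (hre s hs)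
  have hd : DifferentiableOn ℂ (fun s => deriv riemannZeta₁ s / riemannZeta₁ s) (Metric.ball c (3/2)) := by
    refine DifferentiableOn.div ?_ differentiable_riemannZeta₁.differentiableOn hne
    exact differentiable_riemannZeta₁.differentiableOn.deriv Metric.isOpen_ball
  obtain ⟨L, hL0, hL⟩ := hd.isExactOn_ball.with_val_at c 0
  refine ⟨L, fun s hs => (hL s hs).differentiableAt.differentiableWithinAt, hL0, ?_⟩
  have hcm : c ∈ Metric.ball c (3/2) := Metric.mem_ball_self (by norm_num)
  have hconst : ∀ s ∈ Metric.ball c (3/2), riemannZeta₁ s * Complex.exp (-L s) = riemannZeta₁ c * Complex.exp (-L c) := by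
    intro s hs
    refine Metric.isOpen_ball.is_const_of_deriv_eq_zero (𝕜 := ℂ) (f := fun s => riemannZeta₁ s * Complex.exp (-L s)) (convex_ball c (3/2)).isPreconnected ?_ ?_ hs hcm
    · intro z hz
      exact ((differentiable_riemannZeta₁ z).mul (hL z hz).differentiableAt.neg.cexp).differentiableWithinAt
    · intro z hz
      have h1 := (differentiable_riemannZeta₁ z).hasDerivAt.mul (hL z hz).neg.cexp
      have := h1.deriv
      rw [show (fun s => riemannZeta₁ s * Complex.exp (-L s)) = (riemannZeta₁ * fun x => Complex.exp ((-L) x)) from rfl, this]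
      have := hne z hz
      simp only [Pi.zero_apply, Pi.neg_apply]
      field_simp
      ring
  intro s hs
  have h := hconst s hs
  rw [hL0, neg_zero, Complex.exp_zero, mul_one] at h
  rw [← h, mul_assoc, ← Complex.exp_add, neg_add_cancel, Complex.exp_zero, mul_one]

lemma bd_log_bound (hRH : bdRH) : ∃ C : ℝ, 0 < C ∧ ∀ x0 : ℝ, 0 < x0 → x0 < 1/2 → ∀ t : ℝ, ∀ a ∈ Metric.ball (2 + t * I : ℂ) (3/2 - x0),
    ∀ b ∈ Metric.ball (2 + t * I : ℂ) (3/2 - x0), ‖riemannZeta₁ a‖ ≤ ‖riemannZeta₁ b‖ * (3 + |t|) ^ (C / x0 ^ 2 * ‖a - b‖) := by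
  obtain ⟨M, hM, hz⟩ := bd_zeta_right
  have hlM : 0 ≤ Real.log (11 * M) := Real.log_nonneg (by linarith)
  refine ⟨24 * (Real.log (11 * M) + 4), by positivity, fun x0 hx0 hx1 t a ha b hb => ?_⟩
  obtain ⟨L, hLd, hL0, hL⟩ := bd_log_exists hRH t
  set c : ℂ := 2 + t * I with hc
  have ht3 : 0 < 3 + |t| := by positivity
  have hl := bd_log_ge t
  set Mt := (Real.log (11 * M) + 4) * Real.log (3 + |t|) with hMt
  have hMt0 : 0 < Mt := by positivity
  have hcl : 1 ≤ M * ‖riemannZeta₁ c‖ := by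
    have hc1 : c ≠ 1 := by
      intro h; have := congrArg Complex.re h; simp [hc] at this
    rw [zeta1_eq_mul hc1, norm_mul]
    have h1 := (hz c (by simp [hc]; norm_num)).2
    have h2 : 1 ≤ ‖c - 1‖ := by
      refine le_trans ?_ (Complex.abs_re_le_norm _)
      simp [hc]; norm_num
    calc 1 ≤ _ := h1
      _ = M * (1 * ‖riemannZeta c‖) := by ring
      _ ≤ _ := by gcongr
  have hcpos : 0 < ‖riemannZeta₁ c‖ := by
    by_contra! h
    nlinarith
  have hRe : ∀ s ∈ Metric.ball c (3/2), (L s).re ≤ Mt := by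
    intro s hs
    have h1 := congrArg norm (hL s hs)
    rw [norm_mul, Complex.norm_exp] at h1
    rw [mem_ball_iff_norm] at hs
    have h2 : ‖s‖ ≤ 4 + |t| := by
      have e1 : ‖c‖ ≤ 2 + |t| := by
        refine (bd_norm_le_strip (by simp [hc]) (by simp [hc])).trans (by simp [hc])
      have := norm_add_le (s - c) c
      rw [sub_add_cancel] at this
      linarith
    have h3 : 1/10 ≤ s.re := by
      have h1 := (abs_le.mp (Complex.abs_re_le_norm (s - c))).1
      simp [hc] at h1
      rw [← hc] at h1
      linarith
    have h4 := zeta1_bound h3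
    have h5 : ‖riemannZeta₁ s‖ ≤ 11 * (3 + |t|) ^ 4 := by
      refine h4.trans ?_
      rw [show (3 + |t|) ^ 4 = ((3 + |t|) ^ 2) ^ 2 by ring]
      gcongr
      nlinarith [abs_nonneg t]
    have h6 : Real.exp (L s).re ≤ 11 * M * (3 + |t|) ^ 4 := by
      calc Real.exp (L s).re = 1 * Real.exp (L s).re := by ring
        _ ≤ M * ‖riemannZeta₁ c‖ * Real.exp (L s).re := by gcongr
        _ = M * ‖riemannZeta₁ s‖ := by rw [h1]; ring
        _ ≤ M * (11 * (3 + |t|) ^ 4) := by gcongr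
        _ = _ := by ring
    have h7 := (Real.le_log_iff_exp_le (by positivity)).mpr h6
    rw [Real.log_mul (by positivity) (by positivity), Real.log_pow] at h7
    push_cast at h7
    rw [hMt]
    nlinarith
  have hLb : ∀ s ∈ Metric.ball c (3/2 - x0/2), ‖L s‖ ≤ 6 * Mt / x0 := by
    intro s hs
    rw [mem_ball_iff_norm] at hs
    have hcomp : DifferentiableOn ℂ (fun z => L (c + z)) (Metric.ball 0 (3/2)) := by
      refine hLd.comp (by fun_prop) ?_
      intro z hz; rw [mem_ball_zero_iff] at hz; rw [mem_ball_iff_norm]; simpa using hz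
    have := Complex.borelCaratheodory_zero (f := fun z => L (c + z)) (z := s - c) (R := 3/2) hMt0 hcomp (by
      intro z hz
      apply hRe
      rw [mem_ball_zero_iff] at hz; rw [mem_ball_iff_norm]; simpa using hz) (by norm_num) (by
      rw [mem_ball_zero_iff]; linarith) (by simp [hL0])
    simp only [add_sub_cancel] at this
    refine this.trans ?_
    rw [div_le_div_iff₀ (by linarith) hx0]
    have hn := norm_nonneg (s - c)
    have : ‖s - c‖ * x0 ≤ 3 * (3/2 - ‖s - c‖) := by nlinarith
    calc _ = 2 * Mt * (‖s - c‖ * x0) := by ring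
      _ ≤ 2 * Mt * (3 * (3/2 - ‖s - c‖)) := by gcongr
      _ = _ := by ring
  have hD : ∀ s ∈ Metric.ball c (3/2 - x0), ‖deriv L s‖ ≤ 24 * Mt / x0 ^ 2 := by
    intro s hs
    rw [mem_ball_iff_norm] at hs
    have hsub : Metric.closedBall s (x0/4) ⊆ Metric.ball c (3/2 - x0/2) := by
      intro z hz
      rw [mem_closedBall_iff_norm] at hz
      rw [mem_ball_iff_norm]
      have := norm_add_le (z - s) (s - c)
      rw [sub_add_sub_cancel] at this
      linarith
    have := Complex.norm_deriv_le_of_forall_mem_sphere_norm_le (f := L) (c := s) (R := x0/4) (C := 6 * Mt / x0) (by linarith)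
      (DifferentiableOn.diffContOnCl (hLd.mono (by
        refine (closure_mono Metric.ball_subset_closedBall).trans ?_
        rw [Metric.isClosed_closedBall.closure_eq]
        exact hsub.trans (Metric.ball_subset_ball (by linarith)))))
      (fun z hz => hLb z (hsub (Metric.sphere_subset_closedBall hz)))
    refine this.trans (le_of_eq ?_)
    field_simp
    ring
  have hlip : ‖L a - L b‖ ≤ 24 * Mt / x0 ^ 2 * ‖a - b‖ := by
    refine Convex.norm_image_sub_le_of_norm_deriv_le (𝕜 := ℂ) (s := Metric.ball c (3/2 - x0)) ?_ hD (convex_ball _ _) hb ha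
    intro z hz
    exact hLd.differentiableAt (Metric.isOpen_ball.mem_nhds (Metric.ball_subset_ball (by linarith) hz))
  have ha' := hL a (Metric.ball_subset_ball (by linarith) ha)
  have hb' := hL b (Metric.ball_subset_ball (by linarith) hb)
  have e1 : riemannZeta₁ a = riemannZeta₁ b * Complex.exp (L a - L b) := by
    rw [ha', hb', mul_assoc, ← Complex.exp_add]; congr 2; ring
  rw [e1, norm_mul, Complex.norm_exp]
  gcongr
  rw [Real.rpow_def_of_pos ht3, Real.exp_le_exp]
  calc (L a - L b).re ≤ _ := Complex.re_le_norm _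
    _ ≤ _ := hlip
    _ = _ := by rw [hMt]; ring

lemma bd_inv_Z (hRH : bdRH) : ∃ C : ℝ, 0 < C ∧ ∃ M : ℝ, 0 < M ∧ ∀ x0 : ℝ, 0 < x0 → x0 < 1/2 → ∀ s : ℂ, 1/2 + x0 < s.re → s.re ≤ 2 →
    1 ≤ M * (3 + |s.im|) ^ (C / x0 ^ 2) * ‖riemannZeta₁ s‖ := by
  obtain ⟨C, hC, h⟩ := bd_log_bound hRH
  obtain ⟨M, hM, hz⟩ := bd_zeta_right
  refine ⟨2 * C, by positivity, M, by linarith, fun x0 hx0 hx1 s hs1 hs2 => ?_⟩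
  set c : ℂ := 2 + s.im * I with hc
  have hsc : s - c = ((s.re - 2 : ℝ) : ℂ) := by
    apply Complex.ext <;> simp [hc]
  have hn : ‖s - c‖ = 2 - s.re := by
    rw [hsc, Complex.norm_real, Real.norm_eq_abs, abs_of_nonpos (by linarith)]; ring
  have hcl : 1 ≤ M * ‖riemannZeta₁ c‖ := by
    have hc1 : c ≠ 1 := by
      intro h; have := congrArg Complex.re h; simp [hc] at this
    rw [zeta1_eq_mul hc1, norm_mul]
    have h1 := (hz c (by simp [hc]; norm_num)).2
    have h2 : 1 ≤ ‖c - 1‖ := by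
      refine le_trans ?_ (Complex.abs_re_le_norm _)
      simp [hc]; norm_num
    calc 1 ≤ _ := h1
      _ = M * (1 * ‖riemannZeta c‖) := by ring
      _ ≤ _ := by gcongr
  have h1 := h x0 hx0 hx1 s.im c (Metric.mem_ball_self (by linarith)) s (by rw [mem_ball_iff_norm, ← hc, hn]; linarith)
  have h2 : (3 + |s.im|) ^ (C / x0 ^ 2 * ‖c - s‖) ≤ (3 + |s.im|) ^ (2 * C / x0 ^ 2) := by
    apply Real.rpow_le_rpow_of_exponent_le (by linarith [abs_nonneg s.im])
    rw [norm_sub_rev, hn, show 2 * C / x0 ^ 2 = C / x0 ^ 2 * 2 by ring]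
    gcongr; linarith
  calc 1 ≤ M * ‖riemannZeta₁ c‖ := hcl
    _ ≤ M * (‖riemannZeta₁ s‖ * (3 + |s.im|) ^ (C / x0 ^ 2 * ‖c - s‖)) := by gcongr
    _ ≤ M * (‖riemannZeta₁ s‖ * (3 + |s.im|) ^ (2 * C / x0 ^ 2)) := by gcongr
    _ = _ := by ring

lemma bd_A (hRH : bdRH) : ∃ C : ℝ, 0 < C ∧ ∀ ε : ℝ, 0 < ε → ε ≤ 3/5 → ∀ t : ℝ,
    ‖riemannZeta₁ (bdS t)‖ ≤ C * (3 + |t|) ^ (ε / 2) * ‖riemannZeta₁ (bdS t + ε)‖ := by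
  obtain ⟨C1, hC1, M1, hM1, hinv⟩ := bd_inv_Z hRH
  obtain ⟨C, hC, hFE⟩ := bd_FE
  obtain ⟨M, hM, hz⟩ := bd_zeta_right
  refine ⟨2 * C + 2 * M ^ 2, by positivity, fun ε hε hε2 t => ?_⟩
  set δ := ε / 2 with hδ
  have hδ0 : 0 < δ := by positivity
  have hεδ : ε = 2 * δ := by rw [hδ]; ring
  set q : ℂ → ℂ := fun s => riemannZeta₁ (s - ε) / riemannZeta₁ s / (s + 1) ^ (δ : ℂ) with hq
  have hpow : ∀ s : ℂ, ‖(s + 1) ^ (δ : ℂ)‖ = ‖s + 1‖ ^ δ := fun s => Complex.norm_cpow_real _ _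
  have hqn : ∀ s : ℂ, ‖q s‖ = ‖riemannZeta₁ (s - ε)‖ / ‖riemannZeta₁ s‖ / ‖s + 1‖ ^ δ := by
    intro s; simp only [hq, norm_div, hpow]
  have hs1 : ∀ s : ℂ, 1/2 ≤ s.re → 1 ≤ ‖s + 1‖ := by
    intro s hs
    refine le_trans ?_ (Complex.abs_re_le_norm _)
    refine le_trans ?_ (le_abs_self _)
    simp; linarith
  have hZ : ∀ s : ℂ, 1/2 + δ ≤ s.re → 0 < ‖riemannZeta₁ s‖ := fun s hs => norm_pos_iff.mpr (bd_Z_ne hRH (by linarith))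
  have hkey : ‖q (bdS t + ε)‖ ≤ 2 * C + 2 * M ^ 2 := by
    refine bd_vstrip (a := 1/2 + δ) (b := 2) (by linarith) ?_ ⟨11 * 9 * M1 * 3 ^ (C1 / (δ/2) ^ 2), 2 + C1 / (δ/2) ^ 2, ?_⟩ ?_ ?_ ?_ ?_
    · intro s h1 h2
      have e1 : DifferentiableAt ℂ (fun s : ℂ => riemannZeta₁ (s - ε)) s :=
        (differentiable_riemannZeta₁.comp (differentiable_id.sub_const (ε : ℂ))) s
      have e2 : s + 1 ∈ Complex.slitPlane := by left; simp; linarith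
      have e3 : DifferentiableAt ℂ (fun s : ℂ => (s + 1) ^ (δ : ℂ)) s :=
        (differentiableAt_id.add_const 1).cpow_const e2
      refine (e1.div (differentiable_riemannZeta₁ s) (bd_Z_ne hRH (by linarith))).div e3 ?_
      rw [Complex.cpow_ne_zero_iff]; left; exact Complex.slitPlane_ne_zero e2
    · intro s h1 h2 h3
      rw [hqn]
      have g1 : 1 ≤ ‖s + 1‖ ^ δ := Real.one_le_rpow (hs1 s (by linarith)) hδ0.le
      have g2 := hinv (δ/2) (by linarith) (by linarith) s (by linarith) h2
      have g3 := zeta1_bound (s := s - ε) (by simp; linarith)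
      have g4 : ‖s - ε‖ ≤ 2 + |s.im| := by
        refine (bd_norm_le_strip (by simp; linarith) (by simp; linarith)).trans (by simp)
      have hp := hZ s h1
      set K := C1 / (δ/2) ^ 2 with hK
      have hK0 : 0 < K := by positivity
      have g5 : 3 + |s.im| ≤ 3 * Real.exp |s.im| := by linarith [Real.add_one_le_exp |s.im|, abs_nonneg s.im]
      calc _ ≤ ‖riemannZeta₁ (s - ε)‖ / ‖riemannZeta₁ s‖ := div_le_self (by positivity) g1
        _ ≤ ‖riemannZeta₁ (s - ε)‖ * (M1 * (3 + |s.im|) ^ K) := by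
            rw [div_le_iff₀ hp, mul_assoc]
            exact le_mul_of_one_le_right (norm_nonneg _) g2
        _ ≤ (11 * (3 * Real.exp |s.im|) ^ 2) * (M1 * (3 * Real.exp |s.im|) ^ K) := by
            gcongr
            refine g3.trans ?_
            gcongr
            linarith
        _ = _ := by
            rw [Real.mul_rpow (by norm_num) (Real.exp_pos _).le, mul_pow, ← Real.exp_mul, ← Real.exp_nat_mul, add_mul, Real.exp_add,
              mul_comm |s.im| K]
            push_cast
            ring
    · intro s h1
      rw [hqn, div_div, div_le_iff₀ (by have := hZ s h1.ge; have := hs1 s (by linarith); positivity)]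
      set w : ℂ := (starRingEnd ℂ) s with hw
      have hwre : w.re = s.re := by simp [hw]
      have hwim : |w.im| = |s.im| := by simp [hw]
      have e1 : s - ε = 1 - w := by
        apply Complex.ext
        · rw [Complex.sub_re, Complex.sub_re, hwre, h1, hεδ]; simp; ring
        · simp [hw]
      have e2 := hFE w (by rw [hwre, h1]; linarith) (by rw [hwre, h1]; linarith) (by
        refine le_trans ?_ (Complex.abs_re_le_norm _)
        rw [Complex.sub_re, hwre, h1, Complex.one_re, abs_of_nonpos (by linarith)]; linarith)
      rw [← e1, hwre, hwim, h1, add_sub_cancel_left, hw, zeta1_conj, Complex.norm_conj] at e2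
      have e3 : 1 + |s.im| ≤ 2 * ‖s + 1‖ := by
        have a1 := hs1 s (by linarith)
        have a2 := Complex.abs_im_le_norm (s + 1)
        simp at a2
        linarith
      have e4 : (1 + |s.im|) ^ δ ≤ 2 * ‖s + 1‖ ^ δ := by
        calc _ ≤ (2 * ‖s + 1‖) ^ δ := by gcongr
          _ = 2 ^ δ * ‖s + 1‖ ^ δ := Real.mul_rpow (by norm_num) (norm_nonneg _)
          _ ≤ 2 ^ (1:ℝ) * ‖s + 1‖ ^ δ := by
              gcongr
              · norm_num
              · linarith
          _ = _ := by rw [Real.rpow_one]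
      calc _ ≤ _ := e2
        _ ≤ C * (2 * ‖s + 1‖ ^ δ) * ‖riemannZeta₁ s‖ := by gcongr
        _ = 2 * C * (‖riemannZeta₁ s‖ * ‖s + 1‖ ^ δ) := by ring
        _ ≤ _ := by
          refine mul_le_mul_of_nonneg_right ?_ (by positivity)
          nlinarith [sq_nonneg M]
    · intro s h1
      rw [hqn]
      have g1 : 1 ≤ ‖s + 1‖ ^ δ := Real.one_le_rpow (hs1 s (by linarith)) hδ0.le
      have hp := hZ s (by linarith)
      refine (div_le_self (by positivity) g1).trans ?_
      rw [div_le_iff₀ hp]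
      have n1 : s - ε ≠ 1 := by
        intro h; have := congrArg Complex.re h; simp at this; linarith
      have n2 : s ≠ 1 := by
        intro h; have := congrArg Complex.re h; simp at this; linarith
      have b1 := (hz (s - ε) (by simp; linarith)).1
      have b2 := (hz s (by linarith)).2
      have b3 : ‖s - ε - 1‖ ≤ 2 * ‖s - 1‖ := by
        have a1 : 1 ≤ ‖s - 1‖ := by
          refine le_trans ?_ (Complex.abs_re_le_norm _)
          refine le_trans ?_ (le_abs_self _)
          simp; linarith
        have a2 := norm_sub_le (s - 1) ε
        rw [Complex.norm_real, Real.norm_of_nonneg hε.le, sub_right_comm] at a2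
        linarith
      rw [zeta1_eq_mul n1, zeta1_eq_mul n2, norm_mul, norm_mul]
      calc _ ≤ 2 * ‖s - 1‖ * (M * 1) := by rw [mul_one]; gcongr
        _ ≤ 2 * ‖s - 1‖ * (M * (M * ‖riemannZeta s‖)) := by gcongr
        _ = 2 * M ^ 2 * (‖s - 1‖ * ‖riemannZeta s‖) := by ring
        _ ≤ _ := by
          refine mul_le_mul_of_nonneg_right ?_ (by positivity)
          linarith
    · simp [bdS_re]; linarith
    · simp [bdS_re]; linarith
  rw [hqn, add_sub_cancel_right, div_div, div_le_iff₀ (by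
    have := hZ (bdS t + ε) (by simp [bdS_re]; linarith)
    have := hs1 (bdS t + ε) (by simp [bdS_re]; linarith)
    positivity)] at hkey
  have e5 : ‖bdS t + ε + 1‖ ≤ 3 + |t| := by
    refine (Complex.norm_le_abs_re_add_abs_im _).trans ?_
    simp [bdS_re, bdS_im]
    rw [abs_of_pos (by linarith)]; linarith
  calc _ ≤ _ := hkey
    _ ≤ (2 * C + 2 * M ^ 2) * (‖riemannZeta₁ (bdS t + ε)‖ * (3 + |t|) ^ δ) := by gcongr
    _ = _ := by ring

lemma bd_ae_ne : ∀ᵐ t : ℝ, riemannZeta (bdS t) ≠ 0 := by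
  have hc : riemannZetaZeros.Countable :=
    IsLindelof.countable_of_isDiscrete (HereditarilyLindelofSpace.isLindelof _) isDiscrete_riemannZetaZeros
  have hinj : Function.Injective bdS := by
    intro a b h
    rw [← bdS_im a, ← bdS_im b, h]
  have h2 := (hc.preimage hinj).measure_zero volume
  rw [ae_iff]
  convert h2 using 2
  ext t; simp [mem_riemannZetaZeros]

/-- the reciprocal of zeta, via the entire function -/
noncomputable def bdR (w : ℂ) : ℂ := (w - 1) / riemannZeta₁ w

noncomputable def bdH (z : ℂ) (t : ℝ) : ℂ := riemannZeta (bdS t) / bdS t * bdR (bdS t + z)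

lemma bdR_diff (hRH : bdRH) : DifferentiableOn ℂ bdR {w | 1/2 < w.re} := by
  refine DifferentiableOn.div (by fun_prop) differentiable_riemannZeta₁.differentiableOn (fun w hw => bd_Z_ne hRH hw)

lemma bd_open_half : IsOpen {w : ℂ | 1/2 < w.re} := isOpen_lt continuous_const Complex.continuous_re

lemma bdg_cont : Continuous (fun t => riemannZeta (bdS t) / bdS t) := bdZ_cont.div bdS_cont bdS_ne_zero

lemma bdH_cont (hRH : bdRH) {z : ℂ} (hz : 0 < z.re) : Continuous (bdH z) := by
  refine bdg_cont.mul ?_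
  refine (bdR_diff hRH).continuousOn.comp_continuous (bdS_cont.add continuous_const) (fun t => ?_)
  simp [bdS_re]; linarith

lemma bd_H_aux (hRH : bdRH) : ∃ C : ℝ, 0 < C ∧ ∀ z : ℂ, 0 < z.re → z.re ≤ 3/5 → |z.im| ≤ 1 → ∀ t : ℝ,
    ‖riemannZeta₁ (bdS t + z.re)‖ ≤ ‖riemannZeta₁ (bdS t + z)‖ * (3 + |t|) ^ (1/20 : ℝ) → ‖bdH z t‖ ≤ C * bdW t := by
  obtain ⟨C, hC, hA⟩ := bd_A hRH
  refine ⟨9 * (C * 9), by positivity, fun z h1 h2 h3 t h4 => ?_⟩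
  have hpos : 0 < ‖riemannZeta₁ (bdS t + z)‖ := norm_pos_iff.mpr (bd_Z_ne hRH (by simp [bdS_re]; linarith))
  have hA' := hA z.re h1 h2 t
  have hs0 : ‖bdS t‖ ≠ 0 := norm_ne_zero_iff.mpr (bdS_ne_zero t)
  have e1 : ‖bdH z t‖ = (‖riemannZeta₁ (bdS t)‖ * ‖bdS t + z - 1‖ / ‖riemannZeta₁ (bdS t + z)‖) / ‖bdS t‖ ^ 2 := by
    rw [bdH, bdR, norm_mul, norm_div, norm_div, zeta1_eq_mul (bdS_ne_one t), norm_mul, bdS_norm_sub_one]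
    field_simp
  rw [e1]
  have h3t : (0:ℝ) < 3 + |t| := by positivity
  have h1t : (0:ℝ) < 1 + |t| := by positivity
  have hn : ‖bdS t + z - 1‖ ≤ 3 + |t| := by
    have a1 := norm_add_le (bdS t - 1) z
    rw [bdS_norm_sub_one] at a1
    have a2 := bdS_upper t
    have a3 : ‖z‖ ≤ 2 := by
      refine (Complex.norm_le_abs_re_add_abs_im z).trans ?_
      rw [abs_of_pos h1]; linarith
    rw [add_sub_right_comm]
    linarith
  refine bdW_ge (by positivity) ?_
  rw [div_le_iff₀ hpos]
  have h5 : (3 + |t|) ^ (z.re / 2) ≤ (3 + |t|) ^ (3/10 : ℝ) := by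
    apply Real.rpow_le_rpow_of_exponent_le <;> linarith [abs_nonneg t]
  have h6 : (3 + |t|) ^ (11/8 : ℝ) ≤ 9 * (1 + |t|) ^ (11/8 : ℝ) := by
    calc _ ≤ (3 * (1 + |t|)) ^ (11/8 : ℝ) := by gcongr; linarith [abs_nonneg t]
      _ = 3 ^ (11/8 : ℝ) * (1 + |t|) ^ (11/8 : ℝ) := Real.mul_rpow (by norm_num) h1t.le
      _ ≤ 3 ^ (2 : ℝ) * (1 + |t|) ^ (11/8 : ℝ) := by
          gcongr <;> norm_num
      _ = _ := by norm_num
  have h7 : (3 + |t|) ^ (27/20 : ℝ) ≤ (3 + |t|) ^ (11/8 : ℝ) := by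
    apply Real.rpow_le_rpow_of_exponent_le
    · linarith [abs_nonneg t]
    · norm_num
  calc ‖riemannZeta₁ (bdS t)‖ * ‖bdS t + z - 1‖
      ≤ (C * (3 + |t|) ^ (3/10 : ℝ) * (‖riemannZeta₁ (bdS t + z)‖ * (3 + |t|) ^ (1/20 : ℝ))) * (3 + |t|) := by
        gcongr
        refine hA'.trans ?_
        gcongr
    _ = C * ((3 + |t|) ^ (3/10 : ℝ) * (3 + |t|) ^ (1/20 : ℝ) * (3 + |t|) ^ (1 : ℝ)) * ‖riemannZeta₁ (bdS t + z)‖ := by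
        rw [Real.rpow_one]; ring
    _ = C * ((3 + |t|) ^ (27/20 : ℝ)) * ‖riemannZeta₁ (bdS t + z)‖ := by
        rw [← Real.rpow_add h3t, ← Real.rpow_add h3t]; norm_num
    _ ≤ C * ((3 + |t|) ^ (11/8 : ℝ)) * ‖riemannZeta₁ (bdS t + z)‖ := by
        exact mul_le_mul_of_nonneg_right (mul_le_mul_of_nonneg_left h7 hC.le) (norm_nonneg _)
    _ ≤ C * (9 * (1 + |t|) ^ (11/8 : ℝ)) * ‖riemannZeta₁ (bdS t + z)‖ := by gcongr
    _ = _ := by ring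

lemma bd_H_real (hRH : bdRH) : ∃ C : ℝ, 0 < C ∧ ∀ ε : ℝ, 0 < ε → ε ≤ 3/5 → ∀ t : ℝ, ‖bdH ε t‖ ≤ C * bdW t := by
  obtain ⟨C, hC, h⟩ := bd_H_aux hRH
  refine ⟨C, hC, fun ε h1 h2 t => h ε (by simpa) (by simpa) (by simp) t ?_⟩
  simp only [Complex.ofReal_re]
  refine le_mul_of_one_le_right (norm_nonneg _) ?_
  exact Real.one_le_rpow (by linarith [abs_nonneg t]) (by norm_num)

lemma bd_H_cplx (hRH : bdRH) {x0 : ℝ} (hx0 : 0 < x0) (hx1 : x0 < 1/2) : ∃ C : ℝ, 0 < C ∧ ∃ η : ℝ, 0 < η ∧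
    ∀ z : ℂ, x0 ≤ z.re → z.re ≤ 3/5 → |z.im| ≤ η → ∀ t : ℝ, ‖bdH z t‖ ≤ C * bdW t := by
  obtain ⟨C, hC, h⟩ := bd_H_aux hRH
  obtain ⟨C', hC', h'⟩ := bd_log_bound hRH
  set K := C' / (x0/2) ^ 2 with hK
  have hK0 : 0 < K := by positivity
  refine ⟨C, hC, min (x0/4) (1/(20 * K)), by positivity, fun z h1 h2 h3 t => ?_⟩
  have h4 : |z.im| ≤ x0/4 := h3.trans (min_le_left _ _)
  have h5 : |z.im| ≤ 1/(20 * K) := h3.trans (min_le_right _ _)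
  refine h z (by linarith) h2 (by linarith) t ?_
  have ea : bdS t + z.re - (2 + t * I) = ((z.re - 3/2 : ℝ) : ℂ) := by
    apply Complex.ext <;> simp [bdS]; ring
  have na : ‖bdS t + z.re - (2 + t * I)‖ = 3/2 - z.re := by
    rw [ea, Complex.norm_real, Real.norm_eq_abs, abs_of_nonpos (by linarith)]; ring
  have eab : bdS t + z.re - (bdS t + z) = -(z.im * I) := by
    apply Complex.ext <;> simp
  have nab : ‖bdS t + z.re - (bdS t + z)‖ = |z.im| := by
    rw [eab, norm_neg, norm_mul, Complex.norm_I, mul_one, Complex.norm_real, Real.norm_eq_abs]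
  have nb : ‖bdS t + z - (2 + t * I)‖ ≤ 3/2 - z.re + |z.im| := by
    rw [← na, ← nab, norm_sub_rev (bdS t + z.re) (bdS t + z)]
    have := norm_add_le (bdS t + z.re - (2 + t * I)) (bdS t + z - (bdS t + z.re))
    refine le_trans (le_of_eq ?_) this
    congr 1; ring
  have := h' (x0/2) (by linarith) (by linarith) t (bdS t + z.re) (by rw [mem_ball_iff_norm, na]; linarith)
    (bdS t + z) (by rw [mem_ball_iff_norm]; linarith)
  refine this.trans ?_
  rw [nab, ← hK]
  gcongr
  · linarith [abs_nonneg t]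
  · calc K * |z.im| ≤ K * (1/(20 * K)) := by gcongr
      _ = 1/20 := by field_simp

lemma bd_psi_int {ψ : ℝ → ℂ} (hψ : MemLp ψ 2 volume) : Integrable (fun t => ‖ψ t‖ * bdW t) :=
  (bdW_memLp.integrable_mul hψ.norm).congr (Eventually.of_forall fun t => mul_comm _ _)

lemma bd_vanish {ψ : ℝ → ℂ} (hψ : MemLp ψ 2 volume) (horth : ∀ n, ∫ t, ψ t * bdE n t = 0) {z : ℂ} (hz : 1/2 < z.re) :
    ∫ t, ψ t * bdH z t = 0 := by
  obtain ⟨C, hC, hg⟩ := bd_zeta_div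
  set μ : ℕ → ℂ := fun n => ((ArithmeticFunction.moebius n : ℤ) : ℂ) with hμ
  set F : ℕ → ℝ → ℂ := fun n t => ψ t * (riemannZeta (bdS t) / bdS t * LSeries.term μ (bdS t + z) n) with hF
  have hF0 : ∀ t, F 0 t = 0 := by intro t; simp [hF]
  have hFs : ∀ n t, F (n+1) t = (μ (n+1) * ((n:ℂ) + 1) ^ (-z)) * (ψ t * bdE n t) := by
    intro n t
    have hn : ((n:ℂ) + 1) ≠ 0 := Nat.cast_add_one_ne_zero n
    simp only [hF]
    rw [LSeries.term_of_ne_zero (Nat.succ_ne_zero n), bdE]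
    push_cast
    rw [div_eq_mul_inv (μ (n+1)), ← Complex.cpow_neg, neg_add, Complex.cpow_add _ _ hn]
    ring
  have hEint : ∀ n, Integrable (fun t => ψ t * bdE n t) := fun n => hψ.integrable_mul (bdE_memLp n)
  have hFint : ∀ n, Integrable (F n) := by
    intro n
    cases n with
    | zero => rw [show F 0 = fun _ => 0 from funext hF0]; exact integrable_zero _ _ _
    | succ n => rw [show F (n+1) = _ from funext (hFs n)]; exact (hEint n).const_mul _
  have hzero : ∀ n, ∫ t, F n t = 0 := by
    intro n
    cases n with
    | zero => simp [hF0]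
    | succ n => simp_rw [hFs]; rw [integral_const_mul, horth, mul_zero]
  have hpi := (bd_psi_int hψ).const_mul C
  have hbd : ∀ n t, ‖F n t‖ ≤ C * (‖ψ t‖ * bdW t) * (1 / (n:ℝ) ^ (1/2 + z.re)) := by
    intro n t
    simp only [hF]
    rw [norm_mul, norm_mul]
    have h1 : ‖LSeries.term μ (bdS t + z) n‖ ≤ 1 / (n:ℝ) ^ (1/2 + z.re) := by
      rw [LSeries.norm_term_eq]
      split_ifs with h
      · positivity
      · rw [Complex.add_re, bdS_re]
        have := bd_moebius_norm n
        gcongr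
    have h2 := hg t
    have := bdW_pos t
    calc _ ≤ ‖ψ t‖ * ((C * bdW t) * (1 / (n:ℝ) ^ (1/2 + z.re))) := by gcongr
      _ = _ := by ring
  have hsum : Summable (fun n => ∫ t, ‖F n t‖) := by
    have hs : Summable (fun n : ℕ => 1 / (n:ℝ) ^ (1/2 + z.re)) := Real.summable_one_div_nat_rpow.mpr (by linarith)
    refine Summable.of_nonneg_of_le (fun n => integral_nonneg fun t => norm_nonneg _) (fun n => ?_)
      (hs.mul_left (∫ t, C * (‖ψ t‖ * bdW t)))
    rw [← integral_mul_const]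
    exact integral_mono (hFint n).norm (hpi.mul_const _) (hbd n)
  have hmain := hasSum_integral_of_summable_integral_norm hFint hsum
  have heq : ∀ t, ∑' n, F n t = ψ t * bdH z t := by
    intro t
    simp only [hF]
    rw [tsum_mul_left, tsum_mul_left, bdH]
    congr 2
    change LSeries μ (bdS t + z) = _
    have hre : 1 < (bdS t + z).re := by rw [Complex.add_re, bdS_re]; linarith
    have h1 := LSeries_one_mul_Lseries_moebius hre
    rw [LSeries_one_eq_riemannZeta hre] at h1
    have hw1 : bdS t + z ≠ 1 := by intro h; rw [h] at hre; simp at hre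
    have hz0 : riemannZeta (bdS t + z) ≠ 0 := left_ne_zero_of_mul_eq_one h1
    rw [bdR, zeta1_eq_mul hw1, div_mul_cancel_left₀ (sub_ne_zero.mpr hw1)]
    exact eq_inv_of_mul_eq_one_right h1
  simp_rw [hzero, heq] at hmain
  exact hmain.unique hasSum_zero

noncomputable def bdU (x0 η : ℝ) : Set ℂ := Set.Ioo x0 (3/5) ×ℂ Set.Ioo (-η) η

lemma bdU_open (x0 η : ℝ) : IsOpen (bdU x0 η) := isOpen_Ioo.reProdIm isOpen_Ioo

lemma bdU_conn (x0 η : ℝ) : IsPreconnected (bdU x0 η) :=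
  (((convex_Ioo x0 (3/5)).linear_preimage Complex.reLm).inter
    ((convex_Ioo (-η) η).linear_preimage Complex.imLm)).isPreconnected

lemma bdH_diff (hRH : bdRH) (t : ℝ) {z : ℂ} (hz : 0 < z.re) : HasDerivAt (fun z => bdH z t)
    (riemannZeta (bdS t) / bdS t * deriv bdR (bdS t + z)) z := by
  have h1 : DifferentiableAt ℂ bdR (bdS t + z) :=
    (bdR_diff hRH).differentiableAt (bd_open_half.mem_nhds (by simp [bdS_re]; linarith))
  have h2 := h1.hasDerivAt.comp_const_add (bdS t) z
  exact h2.const_mul _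

lemma bd_G_diff (hRH : bdRH) {ψ : ℝ → ℂ} (hψ : MemLp ψ 2 volume) {x0 η C : ℝ} (hx0 : 0 < x0)
    (hb : ∀ z : ℂ, x0 ≤ z.re → z.re ≤ 3/5 → |z.im| ≤ η → ∀ t : ℝ, ‖bdH z t‖ ≤ C * bdW t) :
    DifferentiableOn ℂ (fun z => ∫ t, ψ t * bdH z t) (bdU x0 η) := by
  have hbU : ∀ z ∈ bdU x0 η, ∀ t : ℝ, ‖bdH z t‖ ≤ C * bdW t := by
    intro z hz t
    obtain ⟨h1, h2⟩ := Complex.mem_reProdIm.mp hz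
    exact hb z h1.1.le h1.2.le (abs_le.mpr ⟨h2.1.le, h2.2.le⟩) t
  have hUre : ∀ z ∈ bdU x0 η, 0 < z.re := fun z hz => hx0.trans (Complex.mem_reProdIm.mp hz).1.1
  intro z0 hz0
  refine DifferentiableAt.differentiableWithinAt ?_
  obtain ⟨r, hr, hball⟩ := Metric.isOpen_iff.mp (bdU_open x0 η) z0 hz0
  have hmeas : ∀ z ∈ bdU x0 η, AEStronglyMeasurable (fun t => ψ t * bdH z t) volume := fun z hz =>
    hψ.1.mul (bdH_cont hRH (hUre z hz)).aestronglyMeasurable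
  have hdc : ContinuousOn (deriv bdR) {w | 1/2 < w.re} :=
    ((bdR_diff hRH).deriv bd_open_half).continuousOn
  have hsub : ∀ z ∈ Metric.ball z0 (r/3), Metric.closedBall z (r/3) ⊆ bdU x0 η := by
    intro z hz w hw
    apply hball
    rw [Metric.mem_ball] at hz ⊢
    rw [Metric.mem_closedBall] at hw
    linarith [dist_triangle w z z0]
  have hpi := (bd_psi_int hψ).const_mul (C / (r/3))
  refine (hasDerivAt_integral_of_dominated_loc_of_deriv_le (μ := volume) (s := Metric.ball z0 (r/3))
    (F := fun z t => ψ t * bdH z t)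
    (F' := fun z t => ψ t * (riemannZeta (bdS t) / bdS t * deriv bdR (bdS t + z)))
    (bound := fun t => C / (r/3) * (‖ψ t‖ * bdW t)) (Metric.ball_mem_nhds _ (by positivity)) ?_ ?_ ?_ ?_ hpi ?_).2.differentiableAt
  · filter_upwards [(bdU_open x0 η).mem_nhds hz0] with z hz using hmeas z hz
  · refine Integrable.mono' ((bd_psi_int hψ).const_mul C) (hmeas z0 hz0) (Eventually.of_forall fun t => ?_)
    rw [norm_mul]
    calc _ ≤ ‖ψ t‖ * (C * bdW t) := by gcongr; exact hbU z0 hz0 t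
      _ = _ := by ring
  · refine hψ.1.mul (Continuous.aestronglyMeasurable (bdg_cont.mul ?_))
    refine hdc.comp_continuous (bdS_cont.add continuous_const) (fun t => ?_)
    have := hUre z0 hz0
    simp [bdS_re]; linarith
  · refine Eventually.of_forall fun t z hz => ?_
    have hzU : ∀ w ∈ Metric.closedBall z (r/3), w ∈ bdU x0 η := fun w hw => hsub z hz hw
    have hzz : 0 < z.re := hUre z (hzU z (Metric.mem_closedBall_self (by positivity)))
    have hd : DiffContOnCl ℂ (fun z => bdH z t) (Metric.ball z (r/3)) := by
      refine DifferentiableOn.diffContOnCl_ball (U := bdU x0 η) (fun w hw => ?_) (hsub z hz)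
      exact (bdH_diff hRH t (hUre w hw)).differentiableAt.differentiableWithinAt
    have := Complex.norm_deriv_le_of_forall_mem_sphere_norm_le (by positivity : 0 < r/3) hd
      (fun w hw => hbU w (hzU w (Metric.sphere_subset_closedBall hw)) t)
    rw [(bdH_diff hRH t hzz).deriv] at this
    rw [norm_mul]
    calc _ ≤ ‖ψ t‖ * (C * bdW t / (r/3)) := by gcongr
      _ = _ := by ring
  · refine Eventually.of_forall fun t z hz => ?_
    exact (bdH_diff hRH t (hUre z (hsub z hz (Metric.mem_closedBall_self (by positivity))))).const_mul _

lemma bd_G_zero (hRH : bdRH) {ψ : ℝ → ℂ} (hψ : MemLp ψ 2 volume) (horth : ∀ n, ∫ t, ψ t * bdE n t = 0)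
    {ε : ℝ} (h0 : 0 < ε) (h1 : ε < 1/2) : ∫ t, ψ t * bdH ε t = 0 := by
  obtain ⟨C, hC, η, hη, hb⟩ := bd_H_cplx hRH (x0 := ε/2) (by linarith) (by linarith)
  have hd := bd_G_diff hRH hψ (by linarith) hb
  have ha := hd.analyticOnNhd (bdU_open _ _)
  have hm : ((11/20 : ℝ) : ℂ) ∈ bdU (ε/2) η := by
    rw [bdU, Complex.mem_reProdIm]
    refine ⟨⟨?_, ?_⟩, ⟨?_, ?_⟩⟩ <;> simp only [Complex.ofReal_re, Complex.ofReal_im] <;> linarith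
  have he : (ε : ℂ) ∈ bdU (ε/2) η := by
    rw [bdU, Complex.mem_reProdIm]
    refine ⟨⟨?_, ?_⟩, ⟨?_, ?_⟩⟩ <;> simp only [Complex.ofReal_re, Complex.ofReal_im] <;> linarith
  have hz := ha.eqOn_zero_of_preconnected_of_eventuallyEq_zero (bdU_conn _ _) hm ?_
  · exact hz he
  · have : {w : ℂ | 1/2 < w.re} ∈ nhds ((11/20 : ℝ) : ℂ) := bd_open_half.mem_nhds (by
      simp only [Set.mem_ofPred_eq, Complex.ofReal_re]; norm_num)
    filter_upwards [this] with w hw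
    exact bd_vanish hψ horth hw

lemma bd_orth (hRH : bdRH) {ψ : ℝ → ℂ} (hψ : MemLp ψ 2 volume) (horth : ∀ n, ∫ t, ψ t * bdE n t = 0) :
    ∫ t, ψ t * (1 / bdS t) = 0 := by
  obtain ⟨C, hC, hb⟩ := bd_H_real hRH
  have hev : ∀ᶠ ε : ℝ in nhdsWithin 0 (Set.Ioi 0), 0 < ε ∧ ε < 1/2 :=
    Ioo_mem_nhdsGT (by norm_num : (0:ℝ) < 1/2)
  have hT : Tendsto (fun ε : ℝ => ∫ t, ψ t * bdH ε t) (nhdsWithin 0 (Set.Ioi 0)) (nhds (∫ t, ψ t * (1 / bdS t))) := by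
    refine tendsto_integral_filter_of_dominated_convergence (fun t => C * (‖ψ t‖ * bdW t)) ?_ ?_
      ((bd_psi_int hψ).const_mul C) ?_
    · filter_upwards [hev] with ε hε
      exact hψ.1.mul (bdH_cont hRH (by simpa using hε.1)).aestronglyMeasurable
    · filter_upwards [hev] with ε hε
      refine Eventually.of_forall fun t => ?_
      rw [norm_mul]
      calc _ ≤ ‖ψ t‖ * (C * bdW t) := by gcongr; exact hb ε hε.1 (by linarith [hε.2]) t
        _ = _ := by ring
    · filter_upwards [bd_ae_ne] with t ht
      have hs1 : bdS t - 1 ≠ 0 := sub_ne_zero.mpr (bdS_ne_one t)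
      have hZ : riemannZeta₁ (bdS t) ≠ 0 := by
        rw [zeta1_eq_mul (bdS_ne_one t)]; exact mul_ne_zero hs1 ht
      have hc : ContinuousAt bdR (bdS t) := by
        unfold bdR
        exact ContinuousAt.div (by fun_prop) differentiable_riemannZeta₁.continuous.continuousAt hZ
      have hlim : Tendsto (fun ε : ℝ => bdS t + (ε : ℂ)) (nhdsWithin 0 (Set.Ioi 0)) (nhds (bdS t)) := by
        have : Continuous (fun ε : ℝ => bdS t + (ε : ℂ)) := by fun_prop
        have h2 := this.tendsto 0
        simp only [Complex.ofReal_zero, add_zero] at h2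
        exact h2.mono_left nhdsWithin_le_nhds
      have h3 := ((hc.tendsto.comp hlim).const_mul (riemannZeta (bdS t) / bdS t)).const_mul (ψ t)
      have h4 : riemannZeta (bdS t) / bdS t * bdR (bdS t) = 1 / bdS t := by
        have := bdS_ne_zero t
        rw [bdR, zeta1_eq_mul (bdS_ne_one t)]
        field_simp
      rw [h4] at h3
      exact h3
  have hz : (fun ε : ℝ => ∫ t, ψ t * bdH ε t) =ᶠ[nhdsWithin 0 (Set.Ioi 0)] fun _ => (0:ℂ) := by
    filter_upwards [hev] with ε hε using bd_G_zero hRH hψ horth hε.1 hε.2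
  exact tendsto_nhds_unique hT (tendsto_const_nhds.congr' hz.symm)

noncomputable def bdEL (n : ℕ) : Lp ℂ 2 (volume : Measure ℝ) := (bdE_memLp n).toLp

noncomputable def bdF0 : Lp ℂ 2 (volume : Measure ℝ) := bd_f0_memLp.toLp

lemma bd_norm_sq (f : Lp ℂ 2 (volume : Measure ℝ)) : ‖f‖ ^ 2 = ∫ t, ‖f t‖ ^ 2 := by
  have h := inner_self_eq_norm_sq_to_K (𝕜 := ℂ) f
  rw [MeasureTheory.L2.inner_def] at h
  simp_rw [inner_self_eq_norm_sq_to_K] at h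
  have h2 : ((∫ t, ‖f t‖ ^ 2 : ℝ) : ℂ) = ((‖f‖ ^ 2 : ℝ) : ℂ) := by
    rw [← integral_complex_ofReal]
    push_cast
    exact h
  exact (Complex.ofReal_injective h2).symm

lemma bd_coe_sum (c : ℕ → ℂ) (s : Finset ℕ) :
    (∑ n ∈ s, c n • bdEL n : Lp ℂ 2 (volume : Measure ℝ)) =ᵐ[volume] fun t => ∑ n ∈ s, c n * bdE n t := by
  classical
  induction s using Finset.induction_on with
  | empty =>
    simp only [Finset.sum_empty]
    exact Lp.coeFn_zero ℂ 2 (volume : Measure ℝ)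
  | insert n s hn ih =>
    rw [Finset.sum_insert hn]
    filter_upwards [ih, Lp.coeFn_add (c n • bdEL n) (∑ n ∈ s, c n • bdEL n), Lp.coeFn_smul (c n) (bdEL n),
      (bdE_memLp n).coeFn_toLp] with t h1 h2 h3 h4
    rw [h2, Pi.add_apply, h1, h3, Pi.smul_apply, smul_eq_mul, Finset.sum_insert hn, bdEL, h4]

lemma bd_mem_closure (hRH : bdRH) : bdF0 ∈ (Submodule.span ℂ (Set.range bdEL)).topologicalClosure := by
  rw [← Submodule.orthogonal_orthogonal_eq_closure, Submodule.mem_orthogonal]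
  intro φ hφ
  rw [Submodule.mem_orthogonal'] at hφ
  have hψ : MemLp (fun t => (starRingEnd ℂ) (φ t)) 2 volume := (Lp.memLp φ).star
  have key : ∀ (f : ℝ → ℂ) (hf : MemLp f 2 volume), inner ℂ φ hf.toLp = ∫ t, (starRingEnd ℂ) (φ t) * f t := by
    intro f hf
    rw [MeasureTheory.L2.inner_def]
    refine integral_congr_ae ?_
    filter_upwards [hf.coeFn_toLp] with t ht
    rw [ht, RCLike.inner_apply, mul_comm]
  rw [bdF0, key]
  refine bd_orth hRH hψ fun n => ?_
  rw [← key _ (bdE_memLp n)]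
  exact hφ _ (Submodule.subset_span ⟨n, rfl⟩)

lemma bd_forward (hRH : bdRH) : Tendsto (fun N : ℕ => Real.sqrt (dNsq N)) atTop (nhds 0) := by
  have hpi := Real.pi_pos
  have hnn : ∀ (N : ℕ) (a : Fin N → ℂ), 0 ≤ (1 / (2 * Real.pi)) * ∫ t : ℝ, ‖1 / bdS t - ∑ n : Fin N, a n * bdE n t‖ ^ 2 :=
    fun N a => mul_nonneg (by positivity) (integral_nonneg fun t => by positivity)
  rw [Metric.tendsto_atTop]
  intro δ hδ
  have hmem := bd_mem_closure hRH
  rw [← SetLike.mem_coe, Submodule.topologicalClosure_coe, Metric.mem_closure_iff] at hmem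
  obtain ⟨x, hx, hd⟩ := hmem δ hδ
  obtain ⟨c, rfl⟩ := Finsupp.mem_span_range_iff_exists_finsupp.mp hx
  obtain ⟨N, hN⟩ : ∃ N, c.support ⊆ Finset.range N := Finset.exists_nat_subset_range _
  refine ⟨N, fun M hM => ?_⟩
  have hsub : c.support ⊆ Finset.range M := hN.trans (Finset.range_subset_range.mpr hM)
  rw [Finsupp.sum_of_support_subset _ hsub _ (by simp)] at hd
  have hval : ∫ t : ℝ, ‖1 / bdS t - ∑ n : Fin M, c n * bdE n t‖ ^ 2 < δ ^ 2 := by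
    rw [dist_eq_norm] at hd
    have h1 : ‖bdF0 - ∑ n ∈ Finset.range M, c n • bdEL n‖ ^ 2 < δ ^ 2 := by gcongr
    rw [bd_norm_sq] at h1
    refine lt_of_eq_of_lt (integral_congr_ae ?_) h1
    filter_upwards [Lp.coeFn_sub bdF0 (∑ n ∈ Finset.range M, c n • bdEL n), bd_coe_sum c (Finset.range M),
      bd_f0_memLp.coeFn_toLp] with t h1 h2 h3
    rw [h1, Pi.sub_apply, h2, bdF0, h3, Finset.sum_range]
  have hle : dNsq M ≤ (1 / (2 * Real.pi)) * ∫ t : ℝ, ‖1 / bdS t - ∑ n : Fin M, c n * bdE n t‖ ^ 2 := by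
    rw [bd_dNsq_eq]
    exact ciInf_le ⟨0, by rintro _ ⟨a, rfl⟩; exact hnn M a⟩ (fun n : Fin M => c n)
  have hlt : dNsq M < δ ^ 2 := by
    refine hle.trans_lt (lt_of_le_of_lt ?_ hval)
    refine mul_le_of_le_one_left (integral_nonneg fun t => by positivity) ?_
    rw [div_le_one (by positivity)]
    linarith [Real.pi_gt_three]
  rw [Real.dist_eq, sub_zero, abs_of_nonneg (Real.sqrt_nonneg _), Real.sqrt_lt' hδ]
  exact hlt

theorem stmt5 :
    (∀ s : ℂ, riemannZeta s = 0 → 0 < s.re → s.re < 1 → s.re = 1 / 2) ↔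
      Tendsto (fun N : ℕ => Real.sqrt (dNsq N)) atTop (nhds 0) := by
  exact ⟨fun h => bd_forward h, bd_converse⟩
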